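/- arXiv:2508.21379 — 8 statements merged into one kernel-verified Lean document; each statement's English description precedes it below -/
import Mathlib

section
/- Fix a constant p ∈ (0,1) and ε > 0. Let G ~ G(n,p) be a random graph on vertex set [n] in which each of the C(n,2) possible edges is present independently with probability p. Then the probability that G admits at least 2^{(1−ε)(1−p)p²n²/8} neighborly strictly metric path systems tends to 1 as n → ∞. -/
open SimpleGraph

/-- A path system on a simple graph `G`: for every pair of distinct vertices a chosen
simple path between them, with `P_{u,v} = P_{v,u}`. -/
structure PathSystem {V : Type*} (G : SimpleGraph V) where
  path : ∀ u v : V, u ≠ v → G.Path u v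
  symm : ∀ (u v : V) (h : u ≠ v), (path v u (Ne.symm h)).val = (path u v h).val.reverse

namespace PathSystem

variable {V : Type*} {G : SimpleGraph V}

/-- A path system is consistent if whenever `a` lies on `P_{u,v}`, the path `P_{u,v}` is
the concatenation of `P_{u,a}` and `P_{a,v}`. -/
def Consistent (P : PathSystem G) : Prop :=
  ∀ (u v : V) (huv : u ≠ v) (a : V) (hua : u ≠ a) (hav : a ≠ v),
    a ∈ (P.path u v huv).val.support →
      (P.path u v huv).val = (P.path u a hua).val.append (P.path a v hav).val

/-- A path system is neighborly if the chosen path between the endpoints of each edge is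
that single edge. -/
def Neighborly (P : PathSystem G) : Prop :=
  ∀ (u v : V) (h : G.Adj u v),
    (P.path u v h.ne).val = SimpleGraph.Walk.cons h SimpleGraph.Walk.nil

/-- The `w`-weight of a walk: the sum of the weights of its edges. -/
def wlen (w : Sym2 V → ℝ) {u v : V} (Q : G.Walk u v) : ℝ :=
  (Q.edges.map w).sum

/-- A path system is metric if for some positive edge weights every chosen path is a
shortest path between its endpoints. -/
def Metric (P : PathSystem G) : Prop :=
  ∃ w : Sym2 V → ℝ, (∀ e ∈ G.edgeSet, 0 < w e) ∧
    ∀ (u v : V) (h : u ≠ v) (Q : G.Path u v),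
      wlen w (P.path u v h).val ≤ wlen w Q.val

/-- A path system is strictly metric if for some positive edge weights every chosen path
is the unique shortest path between its endpoints. -/
def StrictlyMetric (P : PathSystem G) : Prop :=
  ∃ w : Sym2 V → ℝ, (∀ e ∈ G.edgeSet, 0 < w e) ∧
    ∀ (u v : V) (h : u ≠ v) (Q : G.Path u v), Q ≠ P.path u v h →
      wlen w (P.path u v h).val < wlen w Q.val

end PathSystem

theorem SimpleGraph.Walk.IsPath.eq_of_mem_edges_iff {V : Type*} {G : SimpleGraph V} {u v : V}
    {p q : G.Walk u v} (hp : p.IsPath) (hq : q.IsPath)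
    (h : ∀ e, e ∈ p.edges ↔ e ∈ q.edges) : p = q := by
  induction p with
  | nil => exact (Walk.isPath_iff_nil.mp hq).eq_nil.symm
  | @cons u x v hux p ih =>
    cases q with
    | nil => simpa using h s(u, x)
    | @cons _ y _ huy q =>
      rw [Walk.cons_isPath_iff] at hp hq
      have hxy : x = y := by
        have := (h s(u, x)).mp (by simp)
        rw [Walk.edges_cons, List.mem_cons] at this
        rcases this with h1 | h1
        · rcases Sym2.eq_iff.mp h1 with ⟨-, h2⟩ | ⟨h2, h3⟩
          · exact h2
          · exact h3.trans h2
        · exact absurd (q.fst_mem_support_of_mem_edges h1) hq.2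
      subst hxy
      rw [ih hp.1 hq.1]
      intro e
      have he := h e
      rw [Walk.edges_cons, Walk.edges_cons, List.mem_cons, List.mem_cons] at he
      constructor
      · intro h1
        refine (he.mp (Or.inr h1)).resolve_left ?_
        rintro rfl
        exact hp.2 (p.fst_mem_support_of_mem_edges h1)
      · intro h1
        refine (he.mpr (Or.inr h1)).resolve_left ?_
        rintro rfl
        exact hq.2 (q.fst_mem_support_of_mem_edges h1)

namespace PathSystem

instance {V : Type*} [Finite V] (G : SimpleGraph V) : Finite (PathSystem G) := by
  classical
  have := Fintype.ofFinite V
  refine Finite.of_injective (fun P : PathSystem G => P.path) ?_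
  rintro ⟨p, hp⟩ ⟨q, hq⟩ h
  simpa using h

theorem exists_strictlyMetric_sum_le {V : Type*} [Finite V] {G : SimpleGraph V}
    (hG : G.Preconnected) (c : Sym2 V → ℕ) :
    ∃ P : PathSystem G, P.StrictlyMetric ∧ ∀ (u v : V) (h : u ≠ v) (Q : G.Path u v),
      ((P.path u v h).val.edges.map c).sum ≤ (Q.val.edges.map c).sum := by
  classical
  have := Fintype.ofFinite V
  obtain ⟨N, ⟨idx⟩⟩ := Finite.exists_equiv_fin (Sym2 V)
  let W : Sym2 V → ℕ := fun e => c e * 2 ^ N + 2 ^ (idx e : ℕ)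
  let r : List (Sym2 V) → ℕ := fun l => (l.map fun e => 2 ^ (idx e : ℕ)).sum
  have hW (l : List (Sym2 V)) : (l.map W).sum = (l.map c).sum * 2 ^ N + r l := by
    induction l with
    | nil => simp [r]
    | cons e l ih => simp only [List.map_cons, List.sum_cons, ih, W, r]; ring
  have hr (l : List (Sym2 V)) (hl : l.Nodup) :
      r l = ∑ k ∈ l.toFinset.image (fun e => (idx e : ℕ)), 2 ^ k := by
    rw [Finset.sum_image fun x _ y _ h => idx.injective (Fin.ext h), List.sum_toFinset _ hl]
  have hlt (l : List (Sym2 V)) (hl : l.Nodup) : r l < 2 ^ N := by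
    rw [hr l hl]
    apply Nat.geomSum_lt le_rfl
    intro k hk
    obtain ⟨e, -, rfl⟩ := Finset.mem_image.mp hk
    exact (idx e).isLt
  have hle (l l' : List (Sym2 V)) (hl : l.Nodup) (hl' : l'.Nodup)
      (h : (l.map W).sum ≤ (l'.map W).sum) : (l.map c).sum ≤ (l'.map c).sum := by
    rw [hW, hW] at h
    by_contra! hc
    have := Nat.mul_le_mul_right (2 ^ N) (Nat.succ_le_of_lt hc)
    have := hlt l' hl'
    rw [Nat.succ_mul] at *
    omega
  have hinj (l l' : List (Sym2 V)) (hl : l.Nodup) (hl' : l'.Nodup)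
      (h : (l.map W).sum = (l'.map W).sum) (e : Sym2 V) : e ∈ l ↔ e ∈ l' := by
    have hc := le_antisymm (hle l l' hl hl' h.le) (hle l' l hl' hl h.ge)
    rw [hW, hW, hc] at h
    have h' : r l = r l' := by omega
    rw [hr l hl, hr l' hl'] at h'
    have h2 := Finset.geomSum_injective le_rfl h'
    have h3 := Finset.image_injective
      (show Function.Injective fun e => (idx e : ℕ) from fun x y h => idx.injective (Fin.ext h)) h2
    rw [← List.mem_toFinset, h3, List.mem_toFinset]
  have hex (u v : V) : ∃ p : G.Path u v, ∀ q : G.Path u v,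
      (p.val.edges.map W).sum ≤ (q.val.edges.map W).sum := by
    obtain ⟨w⟩ := hG u v
    have : Nonempty (G.Path u v) := ⟨w.toPath⟩
    exact Finite.exists_min fun p : G.Path u v => (p.val.edges.map W).sum
  have huniq {u v : V} (p q : G.Path u v)
      (h : (p.val.edges.map W).sum = (q.val.edges.map W).sum) : p = q :=
    Subtype.ext <| p.2.eq_of_mem_edges_iff q.2 <|
      hinj _ _ p.2.isTrail.edges_nodup q.2.isTrail.edges_nodup h
  choose P hP using hex
  have hrev {u v : V} (p : G.Path u v) :
      (p.reverse.val.edges.map W).sum = (p.val.edges.map W).sum := by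
    simp [List.map_reverse, List.sum_reverse]
  refine ⟨⟨fun u v _ => P u v, fun u v _ => ?_⟩, ⟨fun e => (W e : ℝ), ?_, ?_⟩, ?_⟩
  · have h : P v u = (P u v).reverse := by
      apply huniq
      refine le_antisymm (hP _ _ _) ?_
      rw [hrev, ← hrev (P v u)]
      exact hP _ _ _
    rw [h]
    rfl
  · intro e _
    have : 0 < W e := by positivity
    exact Nat.cast_pos.mpr this
  · intro u v h Q hQ
    have hlt : ((P u v).val.edges.map W).sum < (Q.val.edges.map W).sum :=
      lt_of_le_of_ne (hP u v Q) fun h => hQ (huniq _ _ h).symm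
    have hcast (l : List (Sym2 V)) : (l.map fun e => (W e : ℝ)).sum = ((l.map W).sum : ℕ) := by
      induction l with
      | nil => simp
      | cons e l ih => simp [ih]
    unfold wlen
    rw [hcast, hcast]
    exact_mod_cast hlt
  · intro u v h Q
    exact hle _ _ (P u v).2.isTrail.edges_nodup Q.2.isTrail.edges_nodup (hP u v Q)

end PathSystem

theorem SimpleGraph.Walk.exists_of_sum_edges_lt {V : Type*} {G : SimpleGraph V} {u v : V}
    (p : G.Walk u v) (huv : u ≠ v) (hadj : ¬ G.Adj u v) (c : Sym2 V → ℕ) (k : ℕ)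
    (hc : ∀ e, k ≤ c e) (hp : (p.edges.map c).sum < 3 * k) :
    ∃ x, p.support = [u, x, v] ∧ p.edges = [s(u, x), s(x, v)] := by
  cases p with
  | nil => exact absurd rfl huv
  | cons h p =>
    cases p with
    | nil => exact absurd h hadj
    | cons h' p =>
      rename_i x y
      cases p with
      | nil => exact ⟨x, by simp, by simp⟩
      | cons h'' p =>
        rename_i z
        simp only [Walk.edges_cons, List.map_cons, List.sum_cons] at hp
        have := hc s(u, x)
        have := hc s(x, y)
        have := hc s(y, z)
        omega

open Classical in
/-- Edge lengths making every nonadjacent pair `b i`, `b j` with `(i, j) ∈ F` use the detour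
through `a i`. -/
noncomputable def detourLength {V : Type*} {m : ℕ} (a b : Fin m → V)
    (F : Finset (Fin m × Fin m)) (e : Sym2 V) : ℕ :=
  if ∃ i, e = s(a i, b i) then 6
  else if ∃ i j, (i, j) ∈ F ∧ e = s(a i, b j) then 7
  else if ∃ i j, e = s(a i, b j) then 11
  else 8

section Detour

variable {V : Type*} {m : ℕ} {a b : Fin m → V} {F : Finset (Fin m × Fin m)}

theorem six_le_detourLength (e : Sym2 V) : 6 ≤ detourLength a b F e := by
  unfold detourLength
  split_ifs <;> omega

theorem detourLength_le (e : Sym2 V) : detourLength a b F e ≤ 11 := by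
  unfold detourLength
  split_ifs <;> omega

theorem detourLength_self (i : Fin m) : detourLength a b F s(a i, b i) = 6 := by
  rw [detourLength, if_pos ⟨i, rfl⟩]

theorem detourLength_right (hab : ∀ i j, a i ≠ b j) (i j : Fin m) :
    detourLength a b F s(b i, b j) = 8 := by
  have h (k l) : s(b i, b j) ≠ s(a k, b l) := by
    intro h
    rcases Sym2.eq_iff.mp h with ⟨h, -⟩ | ⟨-, h⟩
    · exact hab _ _ h.symm
    · exact hab _ _ h.symm
  simp [detourLength, h]

theorem mk_eq_mk_iff_of_injective (ha : Function.Injective a) (hb : Function.Injective b)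
    (hab : ∀ i j, a i ≠ b j) (i j k l : Fin m) :
    s(a i, b j) = s(a k, b l) ↔ i = k ∧ j = l := by
  rw [Sym2.eq_iff, ha.eq_iff, hb.eq_iff]
  simp [hab]

theorem detourLength_cross (ha : Function.Injective a) (hb : Function.Injective b)
    (hab : ∀ i j, a i ≠ b j) (i j : Fin m) :
    detourLength a b F s(a i, b j) = if i = j then 6 else if (i, j) ∈ F then 7 else 11 := by
  have h := mk_eq_mk_iff_of_injective ha hb hab
  have h1 : (∃ k, s(a i, b j) = s(a k, b k)) ↔ i = j := by
    simp only [h]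
    constructor
    · rintro ⟨k, rfl, rfl⟩; rfl
    · rintro rfl; exact ⟨i, rfl, rfl⟩
  have h2 : (∃ k l, (k, l) ∈ F ∧ s(a i, b j) = s(a k, b l)) ↔ (i, j) ∈ F := by
    simp only [h]
    constructor
    · rintro ⟨k, l, hF, rfl, rfl⟩; exact hF
    · exact fun hF => ⟨i, j, hF, rfl, rfl⟩
  have h3 : ∃ k l, s(a i, b j) = s(a k, b l) := ⟨i, j, rfl⟩
  simp only [detourLength, h1, h2, h3, if_true]

theorem eq_of_detourLength_lt_eight {x y : V} (h : detourLength a b F s(x, y) < 8) :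
    ∃ i j, x = a i ∧ y = b j ∨ x = b j ∧ y = a i := by
  unfold detourLength at h
  split_ifs at h with h1 h2 h3
  · obtain ⟨i, hi⟩ := h1
    exact ⟨i, i, Sym2.eq_iff.mp hi⟩
  · obtain ⟨i, j, -, hi⟩ := h2
    exact ⟨i, j, Sym2.eq_iff.mp hi⟩
  · omega
  · omega

/-- Given `(i, j)` with `i < j`, the vertex `a i` is the only possible middle vertex of a path of
two edges and length at most `13` from `b i` to `b j`. -/
theorem eq_of_detourLength_add_le (ha : Function.Injective a) (hb : Function.Injective b)
    (hab : ∀ i j, a i ≠ b j) (hF : ∀ t ∈ F, t.1 < t.2) {i j : Fin m} (hij : i < j) {x : V}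
    (hx : detourLength a b F s(b i, x) + detourLength a b F s(x, b j) ≤ 13) : x = a i := by
  have h1 := six_le_detourLength (a := a) (b := b) (F := F) s(b i, x)
  have h2 := six_le_detourLength (a := a) (b := b) (F := F) s(x, b j)
  obtain ⟨k, l, ⟨h, -⟩ | ⟨-, rfl⟩⟩ := eq_of_detourLength_lt_eight
    (show detourLength a b F s(b i, x) < 8 by omega)
  · exact absurd h.symm (hab _ _)
  · rw [Sym2.eq_swap, detourLength_cross ha hb hab] at hx h1
    rw [detourLength_cross ha hb hab] at hx h2
    by_cases hki : k = i
    · rw [hki]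
    · exfalso
      rw [if_neg hki] at hx
      by_cases hkj : k = j
      · subst hkj
        have hn : (k, i) ∉ F := fun h => absurd (hF _ h) (not_lt.mpr hij.le)
        simp [hn] at hx
      · rw [if_neg hkj] at hx
        split_ifs at hx <;> omega

theorem exists_pathSystem_iff_mem_support [Finite V] {G : SimpleGraph V}
    (ha : Function.Injective a) (hb : Function.Injective b) (hab : ∀ i j, a i ≠ b j)
    (hG : ∀ u v, u ≠ v → ∃ k, G.Adj u (b k) ∧ G.Adj (b k) v) (hF : ∀ t ∈ F, t.1 < t.2) :
    ∃ P : PathSystem G, P.Neighborly ∧ P.StrictlyMetric ∧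
      ∀ (i j : Fin m) (hij : i < j), G.Adj (a i) (b i) → G.Adj (a i) (b j) →
        ¬ G.Adj (b i) (b j) →
        ((i, j) ∈ F ↔ a i ∈ (P.path (b i) (b j) (hb.ne hij.ne)).val.support) := by
  have hconn : G.Preconnected := by
    intro u v
    by_cases huv : u = v
    · rw [huv]
    · obtain ⟨k, h1, h2⟩ := hG u v huv
      exact h1.reachable.trans h2.reachable
  obtain ⟨P, hP, hmin⟩ := PathSystem.exists_strictlyMetric_sum_le hconn (detourLength a b F)
  refine ⟨P, ?_, hP, ?_⟩
  · intro u v h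
    have h1 := hmin u v h.ne (Path.singleton h)
    have h2 := detourLength_le (a := a) (b := b) (F := F) s(u, v)
    simp only [Path.singleton, Walk.edges_cons, Walk.edges_nil, List.map_cons,
      List.map_nil, List.sum_cons, List.sum_nil, add_zero] at h1
    replace h1 := h1.trans h2
    generalize (P.path u v h.ne).val = p at h1
    cases p with
    | nil => exact absurd rfl h.ne
    | cons h' p =>
      cases p with
      | nil => rfl
      | cons h'' p =>
        rename_i x y
        simp only [Walk.edges_cons, List.map_cons, List.sum_cons] at h1
        have := six_le_detourLength (a := a) (b := b) (F := F) s(u, x)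
        have := six_le_detourLength (a := a) (b := b) (F := F) s(x, y)
        omega
  · intro i j hij hii haij hbij
    have hne := hb.ne hij.ne
    have htwo (x : V) (h1 : G.Adj (b i) x) (h2 : G.Adj x (b j)) :
        ((P.path (b i) (b j) hne).val.edges.map (detourLength a b F)).sum ≤
          detourLength a b F s(b i, x) + detourLength a b F s(x, b j) := by
      have hpath : (Walk.cons h1 (Walk.cons h2 Walk.nil)).IsPath := by
        simp [Walk.cons_isPath_iff, h1.ne, h2.ne, hne]
      simpa using hmin _ _ hne ⟨_, hpath⟩
    obtain ⟨k, hk1, hk2⟩ := hG _ _ hne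
    have h16 := htwo _ hk1 hk2
    rw [detourLength_right hab, detourLength_right hab] at h16
    obtain ⟨x, hsupp, hedges⟩ := (P.path (b i) (b j) hne).val.exists_of_sum_edges_lt hne hbij
      (detourLength a b F) 6 six_le_detourLength (by omega)
    have hmem : a i ∈ (P.path (b i) (b j) hne).val.support ↔ x = a i := by
      rw [hsupp]
      simp [hab, eq_comm]
    rw [hmem]
    simp only [hedges, List.map_cons, List.map_nil, List.sum_cons, List.sum_nil, add_zero]
      at h16 htwo
    constructor
    · intro h
      have h13 := htwo _ hii.symm haij
      rw [Sym2.eq_swap (a := b i) (b := a i), detourLength_self,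
        detourLength_cross ha hb hab i j, if_neg hij.ne, if_pos h] at h13
      exact eq_of_detourLength_add_le ha hb hab hF hij h13
    · rintro rfl
      by_contra h
      rw [Sym2.eq_swap, detourLength_self, detourLength_cross ha hb hab i j, if_neg hij.ne,
        if_neg h] at h16
      omega

theorem two_pow_card_le_card_pathSystem [Finite V] {G : SimpleGraph V}
    (ha : Function.Injective a) (hb : Function.Injective b) (hab : ∀ i j, a i ≠ b j)
    (hG : ∀ u v, u ≠ v → ∃ k, G.Adj u (b k) ∧ G.Adj (b k) v)
    (S : Finset (Fin m × Fin m))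
    (hS : ∀ t ∈ S, t.1 < t.2 ∧ G.Adj (a t.1) (b t.1) ∧ G.Adj (a t.1) (b t.2) ∧
      ¬ G.Adj (b t.1) (b t.2)) :
    2 ^ S.card ≤ Nat.card {P : PathSystem G // P.Neighborly ∧ P.StrictlyMetric} := by
  have h (F : S.powerset) := exists_pathSystem_iff_mem_support ha hb hab hG
    (F := F.val) fun t ht => (hS t (Finset.mem_powerset.mp F.2 ht)).1
  choose P hP1 hP2 hP3 using h
  rw [← Finset.card_powerset, ← Fintype.card_coe, ← Nat.card_eq_fintype_card]
  refine Nat.card_le_card_of_injective (fun F => ⟨P F, hP1 F, hP2 F⟩) ?_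
  intro F F' hFF
  have hPF : P F = P F' := congrArg Subtype.val hFF
  ext t
  have key (A B : S.powerset) (hAB : P A = P B) (ht : t ∈ A.val) : t ∈ B.val := by
    obtain ⟨h1, h2, h3, h4⟩ := hS t (Finset.mem_powerset.mp A.2 ht)
    have := (hP3 A t.1 t.2 h1 h2 h3 h4).mp ht
    rw [hAB] at this
    exact (hP3 B t.1 t.2 h1 h2 h3 h4).mpr this
  exact ⟨key F F' hPF, key F' F hPF.symm⟩

end Detour

section BinomialSubset

open Finset

variable {α : Type*} {E : Finset α} {p : ℝ}

/-- The expectation of `f A` for the random subset `A` of `E` that contains each element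
independently with probability `p`. -/
noncomputable def binomialExpect (E : Finset α) (p : ℝ) (f : Finset α → ℝ) : ℝ :=
  ∑ A ∈ E.powerset, p ^ #A * (1 - p) ^ (#E - #A) * f A

theorem binomialExpect_mono (hp0 : 0 ≤ p) (hp1 : p ≤ 1) {f g : Finset α → ℝ}
    (h : ∀ A ⊆ E, f A ≤ g A) : binomialExpect E p f ≤ binomialExpect E p g := by
  have : 0 ≤ 1 - p := by linarith
  refine sum_le_sum fun A hA => mul_le_mul_of_nonneg_left (h A (mem_powerset.mp hA)) ?_
  positivity

theorem binomialExpect_congr {f g : Finset α → ℝ} (h : ∀ A, f A = g A) :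
    binomialExpect E p f = binomialExpect E p g := by
  simp [binomialExpect, h]

theorem binomialExpect_add (f g : Finset α → ℝ) :
    binomialExpect E p (fun A => f A + g A) = binomialExpect E p f + binomialExpect E p g := by
  simp [binomialExpect, mul_add, sum_add_distrib]

theorem binomialExpect_const_mul (c : ℝ) (f : Finset α → ℝ) :
    binomialExpect E p (fun A => c * f A) = c * binomialExpect E p f := by
  simp only [binomialExpect, mul_sum]
  exact sum_congr rfl fun A _ => by ring

theorem binomialExpect_sum {ι : Type*} (T : Finset ι) (f : ι → Finset α → ℝ) :
    binomialExpect E p (fun A => ∑ t ∈ T, f t A) = ∑ t ∈ T, binomialExpect E p (f t) := by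
  simp only [binomialExpect, mul_sum]
  exact sum_comm

theorem binomialExpect_const (c : ℝ) : binomialExpect E p (fun _ => c) = c := by
  rw [binomialExpect, ← sum_mul, sum_pow_mul_eq_add_pow]
  simp

open Classical in
/-- The indicator function of the event that the set contains `U` and avoids `W`. -/
noncomputable def cylinderIndicator (U W A : Finset α) : ℝ :=
  if U ⊆ A ∧ Disjoint W A then 1 else 0

theorem cylinderIndicator_nonneg (U W A : Finset α) : 0 ≤ cylinderIndicator U W A := by
  unfold cylinderIndicator
  split_ifs <;> norm_num

theorem cylinderIndicator_mul [DecidableEq α] (U W U' W' A : Finset α) :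
    cylinderIndicator U W A * cylinderIndicator U' W' A =
      cylinderIndicator (U ∪ U') (W ∪ W') A := by
  unfold cylinderIndicator
  rw [ite_zero_mul_ite_zero, one_mul]
  congr 1
  rw [union_subset_iff, disjoint_union_left, and_and_and_comm]

theorem binomialExpect_cylinderIndicator {U W : Finset α} (hU : U ⊆ E) (hW : W ⊆ E)
    (hUW : Disjoint U W) :
    binomialExpect E p (cylinderIndicator U W) = p ^ #U * (1 - p) ^ #W := by
  classical
  have h := prod_add (fun e => if e ∈ W then 0 else p) (fun e => if e ∈ U then 0 else 1 - p) E
  have hl : ∏ e ∈ E, ((if e ∈ W then 0 else p) + (if e ∈ U then 0 else 1 - p)) =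
      p ^ #U * (1 - p) ^ #W := by
    have : ∀ e ∈ E, ((if e ∈ W then 0 else p) + (if e ∈ U then 0 else 1 - p)) =
        (if e ∈ U then p else 1) * (if e ∈ W then 1 - p else 1) := by
      intro e _
      by_cases h1 : e ∈ U
      · have h2 := Finset.disjoint_left.mp hUW h1
        simp [h1, h2]
      · by_cases h2 : e ∈ W <;> simp [h1, h2]
    rw [prod_congr rfl this, prod_mul_distrib, prod_ite_mem, prod_ite_mem,
      inter_eq_right.mpr hU, inter_eq_right.mpr hW, prod_const, prod_const]
  rw [← hl, h, binomialExpect]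
  refine sum_congr rfl fun A hA => ?_
  have hA := mem_powerset.mp hA
  unfold cylinderIndicator
  split_ifs with h1
  · rw [mul_one]
    congr 1
    · rw [prod_congr rfl (g := fun _ => p), prod_const]
      intro e he
      rw [if_neg (disjoint_right.mp h1.2 he)]
    · rw [prod_congr rfl (g := fun _ => 1 - p), prod_const, card_sdiff_of_subset hA]
      intro e he
      rw [if_neg fun h => (mem_sdiff.mp he).2 (h1.1 h)]
  · rw [mul_zero, eq_comm, mul_eq_zero]
    rw [not_and_or] at h1
    rcases h1 with h1 | h1
    · obtain ⟨e, he, heA⟩ := not_subset.mp h1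
      exact Or.inr (prod_eq_zero (mem_sdiff.mpr ⟨hU he, heA⟩) (if_pos he))
    · obtain ⟨e, he, heA⟩ := not_disjoint_iff.mp h1
      exact Or.inl (prod_eq_zero heA (if_pos he))

open Classical in
/-- Chebyshev's inequality for the number of events that occur, among events that all have the same
probability and each prescribe the status of finitely many elements. -/
theorem binomialExpect_card_filter_lt_mul_sq_le [DecidableEq α] (hp0 : 0 ≤ p) (hp1 : p ≤ 1)
    {ι : Type*} (T : Finset ι)
    (U W : ι → Finset α) (hU : ∀ t ∈ T, U t ⊆ E) (hW : ∀ t ∈ T, W t ⊆ E)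
    (hUW : ∀ t ∈ T, Disjoint (U t) (W t)) (x y : ℕ) (hx : ∀ t ∈ T, #(U t) = x)
    (hy : ∀ t ∈ T, #(W t) = y) {s : ℝ} (hs : 0 < s) :
    binomialExpect E p (fun A => if (#{t ∈ T | U t ⊆ A ∧ Disjoint (W t) A} : ℝ) <
        #T * (p ^ x * (1 - p) ^ y) - s then 1 else 0) * s ^ 2 ≤
      #{z ∈ T ×ˢ T | ¬ Disjoint (U z.1 ∪ W z.1) (U z.2 ∪ W z.2)} := by
  set q := p ^ x * (1 - p) ^ y with hq
  have hp1' : 0 ≤ 1 - p := by linarith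
  have hq0 : 0 ≤ q := by positivity
  have hq1 : q ≤ 1 := mul_le_one₀ (pow_le_one₀ hp0 hp1) (by positivity)
    (pow_le_one₀ hp1' (by linarith))
  have hE (t : ι) (ht : t ∈ T) : binomialExpect E p (cylinderIndicator (U t) (W t)) = q := by
    rw [binomialExpect_cylinderIndicator (hU t ht) (hW t ht) (hUW t ht), hx t ht, hy t ht]
  have hcard (A : Finset α) : (#{t ∈ T | U t ⊆ A ∧ Disjoint (W t) A} : ℝ) =
      ∑ t ∈ T, cylinderIndicator (U t) (W t) A := by
    rw [card_filter]
    push_cast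
    refine sum_congr rfl fun t _ => ?_
    by_cases h : U t ⊆ A ∧ Disjoint (W t) A <;> simp [cylinderIndicator, h]
  have hcov (z : ι × ι) (hz : z ∈ T ×ˢ T) :
      binomialExpect E p (fun A => cylinderIndicator (U z.1) (W z.1) A *
          cylinderIndicator (U z.2) (W z.2) A) - q ^ 2 ≤
        if ¬ Disjoint (U z.1 ∪ W z.1) (U z.2 ∪ W z.2) then 1 else 0 := by
    obtain ⟨h1, h2⟩ := mem_product.mp hz
    split_ifs with hd
    · rw [disjoint_union_left, disjoint_union_right, disjoint_union_right] at hd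
      obtain ⟨⟨huu, huw⟩, hwu, hww⟩ := hd
      rw [binomialExpect_congr (cylinderIndicator_mul _ _ _ _),
        binomialExpect_cylinderIndicator (union_subset (hU _ h1) (hU _ h2))
          (union_subset (hW _ h1) (hW _ h2)), card_union_of_disjoint huu,
        card_union_of_disjoint hww, hx _ h1, hx _ h2, hy _ h1, hy _ h2, hq]
      · exact le_of_eq (by ring)
      · simp only [disjoint_union_left, disjoint_union_right]
        exact ⟨⟨hUW _ h1, hwu.symm⟩, huw, hUW _ h2⟩
    · have : binomialExpect E p (fun A => cylinderIndicator (U z.1) (W z.1) A *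
          cylinderIndicator (U z.2) (W z.2) A) ≤ binomialExpect E p (fun _ => 1) := by
        refine binomialExpect_mono hp0 hp1 fun A _ => ?_
        unfold cylinderIndicator
        split_ifs <;> norm_num
      rw [binomialExpect_const] at this
      nlinarith
  have hvar : binomialExpect E p
      (fun A => (∑ t ∈ T, cylinderIndicator (U t) (W t) A - #T * q) ^ 2) =
      ∑ z ∈ T ×ˢ T, (binomialExpect E p (fun A => cylinderIndicator (U z.1) (W z.1) A *
          cylinderIndicator (U z.2) (W z.2) A) - q ^ 2) := by
    have h1 (A : Finset α) : (∑ t ∈ T, cylinderIndicator (U t) (W t) A - #T * q) ^ 2 =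
        (∑ z ∈ T ×ˢ T, cylinderIndicator (U z.1) (W z.1) A * cylinderIndicator (U z.2) (W z.2) A) +
          ((-2 * (#T * q)) * (∑ t ∈ T, cylinderIndicator (U t) (W t) A) + (#T * q) ^ 2) := by
      rw [sum_product]
      dsimp only
      rw [← sum_mul_sum]
      ring
    rw [binomialExpect_congr h1, binomialExpect_add, binomialExpect_add, binomialExpect_const_mul,
      binomialExpect_const, binomialExpect_sum, binomialExpect_sum, sum_congr rfl hE,
      sum_sub_distrib, sum_const, sum_const, card_product]
    simp only [nsmul_eq_mul]
    push_cast
    ring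
  calc _ = binomialExpect E p (fun A => s ^ 2 *
        if (#{t ∈ T | U t ⊆ A ∧ Disjoint (W t) A} : ℝ) < #T * q - s then 1 else 0) := by
        rw [binomialExpect_const_mul, mul_comm]
    _ ≤ binomialExpect E p
        (fun A => (∑ t ∈ T, cylinderIndicator (U t) (W t) A - #T * q) ^ 2) := by
        refine binomialExpect_mono hp0 hp1 fun A _ => ?_
        rw [hcard]
        split_ifs with h
        · nlinarith
        · rw [mul_zero]; positivity
    _ ≤ ∑ z ∈ T ×ˢ T, if ¬ Disjoint (U z.1 ∪ W z.1) (U z.2 ∪ W z.2) then (1 : ℝ) else 0 := by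
        rw [hvar]
        exact sum_le_sum hcov
    _ = _ := by
        rw [sum_boole]

open Classical in
theorem binomialExpect_no_common_neighbor_le {V : Type*} {E : Finset (Sym2 V)} (hp0 : 0 ≤ p)
    (hp1 : p ≤ 1) (hE : ∀ x y, x ≠ y → s(x, y) ∈ E) {u v : V} (huv : u ≠ v) (K : Finset V)
    (hu : u ∉ K) (hv : v ∉ K) :
    binomialExpect E p (fun A => if ∀ c ∈ K, ¬ (s(u, c) ∈ A ∧ s(c, v) ∈ A) then 1 else 0) ≤
      (1 - p ^ 2) ^ #K := by
  have hinj (w : V) : Function.Injective fun c => s(w, c) := fun c d h => Sym2.congr_right.mp h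
  have hu' (c : V) (hc : c ∈ K) : u ≠ c := fun h => hu (h ▸ hc)
  have hv' (c : V) (hc : c ∈ K) : v ≠ c := fun h => hv (h ▸ hc)
  have hcross (c d : V) (hd : d ∈ K) : s(u, c) ≠ s(v, d) := by
    intro h
    rcases Sym2.eq_iff.mp h with ⟨h, -⟩ | ⟨h, -⟩
    · exact huv h
    · exact hu' d hd h
  let Y : Finset V → Finset (Sym2 V) := fun U => U.image fun c => s(u, c)
  let Z : Finset V → Finset (Sym2 V) :=
    fun U => ((K \ U).image fun c => s(u, c)) ∪ U.image fun c => s(v, c)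
  have hcyl (U : Finset V) (hU : U ∈ K.powerset) :
      binomialExpect E p (cylinderIndicator (Y U) (Z U)) =
        (p * (1 - p)) ^ #U * (1 - p) ^ (#K - #U) := by
    have hU := mem_powerset.mp hU
    have hd : Disjoint ((K \ U).image fun c => s(u, c)) (U.image fun c => s(v, c)) := by
      rw [Finset.disjoint_left]
      intro e he he'
      obtain ⟨c, -, rfl⟩ := mem_image.mp he
      obtain ⟨d, hd, h⟩ := mem_image.mp he'
      exact hcross c d (hU hd) h.symm
    rw [binomialExpect_cylinderIndicator]
    · rw [card_union_of_disjoint hd, card_image_of_injective _ (hinj u),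
        card_image_of_injective _ (hinj u), card_image_of_injective _ (hinj v),
        card_sdiff_of_subset hU, mul_pow, pow_add]
      ring
    · exact image_subset_iff.mpr fun c hc => hE _ _ (hu' c (hU hc))
    · refine union_subset ?_ ?_
      · exact image_subset_iff.mpr fun c hc => hE _ _ (hu' c (mem_sdiff.mp hc).1)
      · exact image_subset_iff.mpr fun c hc => hE _ _ (hv' c (hU hc))
    · rw [disjoint_union_right]
      refine ⟨disjoint_image (hinj u) |>.mpr disjoint_sdiff, ?_⟩
      rw [Finset.disjoint_left]
      intro e he he'
      obtain ⟨c, -, rfl⟩ := mem_image.mp he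
      obtain ⟨d, hd, h⟩ := mem_image.mp he'
      exact hcross c d (hU hd) h.symm
  calc _ ≤ binomialExpect E p (fun A => ∑ U ∈ K.powerset, cylinderIndicator (Y U) (Z U) A) := by
        refine binomialExpect_mono hp0 hp1 fun A _ => ?_
        split_ifs with h
        · have hmem : {c ∈ K | s(u, c) ∈ A} ∈ K.powerset := by simp
          refine le_trans ?_ (single_le_sum (fun U _ => cylinderIndicator_nonneg _ _ _) hmem)
          rw [cylinderIndicator, if_pos]
          constructor
          · exact image_subset_iff.mpr fun c hc => (mem_filter.mp hc).2
          · rw [disjoint_union_left, Finset.disjoint_left, Finset.disjoint_left]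
            constructor
            · intro e he heA
              obtain ⟨c, hc, rfl⟩ := mem_image.mp he
              simp only [mem_sdiff, mem_filter, not_and] at hc
              exact hc.2 hc.1 heA
            · intro e he heA
              obtain ⟨c, hc, rfl⟩ := mem_image.mp he
              rw [mem_filter] at hc
              exact h c hc.1 ⟨hc.2, Sym2.eq_swap (a := v) ▸ heA⟩
        · exact sum_nonneg fun U _ => cylinderIndicator_nonneg _ _ _
    _ = (1 - p ^ 2) ^ #K := by
        rw [binomialExpect_sum, sum_congr rfl hcyl, sum_pow_mul_eq_add_pow]
        ring

end BinomialSubset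

section RandomGraph

open Finset

theorem two_mul_card_filter_fst_lt_snd (m : ℕ) :
    2 * #{t : Fin m × Fin m | t.1 < t.2} + m = m ^ 2 := by
  have h1 : #{t : Fin m × Fin m | t.2 < t.1} = #{t : Fin m × Fin m | t.1 < t.2} :=
    card_nbij' Prod.swap Prod.swap (by intro; simp) (by intro; simp) (fun _ _ => rfl)
      (fun _ _ => rfl)
  have h2 : #{t : Fin m × Fin m | t.1 = t.2} = m := by
    have : ({t : Fin m × Fin m | t.1 = t.2} : Finset (Fin m × Fin m)) = univ.diag := by
      ext t
      simp
    rw [this, diag_card, card_univ, Fintype.card_fin]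
  have h3 : (univ : Finset (Fin m × Fin m)) =
      univ.filter (fun t => t.1 < t.2) ∪ univ.filter (fun t => t.2 < t.1) ∪
        univ.filter (fun t => t.1 = t.2) := by
    ext t
    simp only [mem_univ, mem_union, mem_filter, true_and, true_iff]
    rcases lt_trichotomy t.1 t.2 with h | h | h <;> simp [h]
  have h4 : #(univ : Finset (Fin m × Fin m)) = m ^ 2 := by simp [sq]
  rw [h3, card_union_of_disjoint, card_union_of_disjoint, h1, h2] at h4
  · omega
  · rw [disjoint_filter]
    intro t _ h h'
    exact lt_asymm h h'
  · rw [disjoint_union_left, disjoint_filter, disjoint_filter]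
    exact ⟨fun t _ h h' => h.ne h', fun t _ h h' => h.ne h'.symm⟩

open Classical in
/-- The pairs `i < j` for which the nonadjacent vertices `b i`, `b j` are joined by a path through
`a i`, in the graph with edge set `A`. -/
noncomputable def detourPairs {V : Type*} {m : ℕ} (a b : Fin m → V) (A : Finset (Sym2 V)) :
    Finset (Fin m × Fin m) :=
  {t ∈ ({t : Fin m × Fin m | t.1 < t.2} : Finset (Fin m × Fin m)) |
    ({s(a t.1, b t.1), s(a t.1, b t.2)} : Finset (Sym2 V)) ⊆ A ∧
      Disjoint ({s(b t.1, b t.2)} : Finset (Sym2 V)) A}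

theorem two_pow_card_detourPairs_le {V : Type*} [Finite V] {m : ℕ} {a b : Fin m → V}
    (ha : Function.Injective a) (hb : Function.Injective b) (hab : ∀ i j, a i ≠ b j)
    (A : Finset (Sym2 V))
    (hA : ∀ u v, u ≠ v → ∃ k, u ≠ b k ∧ v ≠ b k ∧ s(u, b k) ∈ A ∧ s(b k, v) ∈ A) :
    2 ^ #(detourPairs a b A) ≤ Nat.card {P : PathSystem (SimpleGraph.fromEdgeSet (A : Set (Sym2 V)))
      // P.Neighborly ∧ P.StrictlyMetric} := by
  refine two_pow_card_le_card_pathSystem ha hb hab ?_ _ ?_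
  · intro u v huv
    obtain ⟨k, h1, h2, h3, h4⟩ := hA u v huv
    exact ⟨k, by simpa using ⟨h3, h1⟩, by simpa using ⟨h4, h2.symm⟩⟩
  · intro t ht
    simp only [detourPairs, mem_filter, mem_univ, true_and, insert_subset_iff, singleton_subset_iff,
      disjoint_singleton_left] at ht
    simp [ht, hab]

open Classical in
theorem binomialExpect_card_detourPairs_lt_mul_sq_le {V : Type*} {p : ℝ} (hp0 : 0 ≤ p)
    (hp1 : p ≤ 1) {E : Finset (Sym2 V)} (hE : ∀ x y, x ≠ y → s(x, y) ∈ E) {m : ℕ}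
    {a b : Fin m → V} (ha : Function.Injective a) (hb : Function.Injective b)
    (hab : ∀ i j, a i ≠ b j) {s : ℝ} (hs : 0 < s) :
    binomialExpect E p (fun A => if (#(detourPairs a b A) : ℝ) <
        #{t : Fin m × Fin m | t.1 < t.2} * (p ^ 2 * (1 - p)) - s then 1 else 0) * s ^ 2 ≤
      (m : ℝ) ^ 3 := by
  have hne (i j k l) : s(a i, b j) ≠ s(b k, b l) := by
    intro h
    rcases Sym2.eq_iff.mp h with ⟨h, -⟩ | ⟨h, -⟩ <;> exact hab _ _ h
  have hinj := mk_eq_mk_iff_of_injective ha hb hab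
  have h := binomialExpect_card_filter_lt_mul_sq_le (E := E) hp0 hp1
    ({t : Fin m × Fin m | t.1 < t.2} : Finset (Fin m × Fin m))
    (fun t => {s(a t.1, b t.1), s(a t.1, b t.2)}) (fun t => {s(b t.1, b t.2)})
    (by
      intro t ht
      simp only [insert_subset_iff, singleton_subset_iff]
      exact ⟨hE _ _ (hab _ _), hE _ _ (hab _ _)⟩)
    (by
      intro t ht
      rw [singleton_subset_iff]
      exact hE _ _ (hb.ne (mem_filter.mp ht).2.ne))
    (by
      intro t ht
      simp [hne, eq_comm (a := s(b t.1, b t.2))])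
    2 1
    (by
      intro t ht
      rw [card_pair]
      rw [Ne, hinj]
      exact fun h => (mem_filter.mp ht).2.ne h.2)
    (by simp) hs
  rw [pow_one] at h
  refine h.trans ?_
  have hcard : #(univ : Finset (Fin m × Fin m × Fin m)) = m ^ 3 := by simp; ring
  rw [← Nat.cast_pow, ← hcard, Nat.cast_le]
  refine card_le_card_of_injOn (fun z => (z.1.1, z.1.2, z.2.2)) (fun _ _ => mem_univ _) ?_
  have hfst (z : (Fin m × Fin m) × (Fin m × Fin m)) (h1 : z.1.1 < z.1.2) (h2 : z.2.1 < z.2.2)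
      (hz : ¬ Disjoint (({s(a z.1.1, b z.1.1), s(a z.1.1, b z.1.2)} : Finset (Sym2 V)) ∪
        {s(b z.1.1, b z.1.2)}) ({s(a z.2.1, b z.2.1), s(a z.2.1, b z.2.2)} ∪
        {s(b z.2.1, b z.2.2)})) : z.1.1 = z.2.1 := by
    obtain ⟨e, he, he'⟩ := not_disjoint_iff.mp hz
    simp only [mem_union, mem_insert, mem_singleton] at he he'
    rcases he with (rfl | rfl) | rfl
    · rcases he' with (h | h) | h
      · exact ((hinj _ _ _ _).mp h).1
      · exact ((hinj _ _ _ _).mp h).1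
      · exact absurd h (hne _ _ _ _)
    · rcases he' with (h | h) | h
      · exact ((hinj _ _ _ _).mp h).1
      · exact ((hinj _ _ _ _).mp h).1
      · exact absurd h (hne _ _ _ _)
    · rcases he' with (h | h) | h
      · exact absurd h.symm (hne _ _ _ _)
      · exact absurd h.symm (hne _ _ _ _)
      · rcases Sym2.eq_iff.mp h with ⟨h, -⟩ | ⟨h, h'⟩
        · exact hb h
        · rw [hb h, hb h'] at h1
          exact absurd h1 (lt_asymm h2)
  rintro ⟨⟨i, j⟩, k, l⟩ hz ⟨⟨i', j'⟩, k', l'⟩ hz' h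
  simp only [coe_filter, mem_product, mem_filter, mem_univ, true_and, Set.mem_ofPred_eq] at hz hz'
  have e1 : i = k := hfst ((i, j), (k, l)) hz.1.1 hz.1.2 hz.2
  have e2 : i' = k' := hfst ((i', j'), (k', l')) hz'.1.1 hz'.1.2 hz'.2
  simp only [Prod.mk.injEq] at h ⊢
  obtain ⟨h1, h2, h3⟩ := h
  exact ⟨⟨h1, h2⟩, e1 ▸ e2 ▸ h1, h3⟩

open Classical in
/-- A lower bound for the probability that every two vertices have a common neighbor among the
`b k` and that there are many detour pairs. -/
theorem one_sub_le_binomialExpect_good {V : Type*} [Fintype V] {p : ℝ} (hp0 : 0 ≤ p) (hp1 : p ≤ 1)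
    {E : Finset (Sym2 V)} (hE : ∀ x y, x ≠ y → s(x, y) ∈ E) {m : ℕ}
    {a b : Fin m → V} (ha : Function.Injective a) (hb : Function.Injective b)
    (hab : ∀ i j, a i ≠ b j) {s : ℝ} (hs : 0 < s) :
    1 - ((m : ℝ) ^ 3 / s ^ 2 + (Fintype.card V : ℝ) ^ 2 * (1 - p ^ 2) ^ (m - 2)) ≤
      binomialExpect E p (fun A => if
        #{t : Fin m × Fin m | t.1 < t.2} * (p ^ 2 * (1 - p)) - s ≤ (#(detourPairs a b A) : ℝ) ∧
        ∀ u v, u ≠ v → ∃ k, u ≠ b k ∧ v ≠ b k ∧ s(u, b k) ∈ A ∧ s(b k, v) ∈ A then 1 else 0) := by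
  set M : ℝ := #{t : Fin m × Fin m | t.1 < t.2} * (p ^ 2 * (1 - p)) - s with hM
  have hr0 : 0 ≤ 1 - p ^ 2 := by nlinarith
  have hr1 : 1 - p ^ 2 ≤ 1 := by nlinarith
  let K : V × V → Finset V := fun z => (univ.image b \ {z.1, z.2})
  have hK (z : V × V) : m - 2 ≤ #(K z) := by
    have h1 := le_card_sdiff ({z.1, z.2} : Finset V) (univ.image b)
    have h2 : #({z.1, z.2} : Finset V) ≤ 2 := card_le_two
    rw [card_image_of_injective _ hb, card_univ, Fintype.card_fin] at h1
    exact le_trans (by omega) h1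
  have hnbr (z : V × V) (hz : z.1 ≠ z.2) :
      binomialExpect E p (fun A => if ∀ c ∈ K z, ¬ (s(z.1, c) ∈ A ∧ s(c, z.2) ∈ A) then 1 else 0) ≤
        (1 - p ^ 2) ^ (m - 2) := by
    refine le_trans (le_of_eq ?_) ((binomialExpect_no_common_neighbor_le hp0 hp1 hE hz (K z) (by simp [K]) (by simp [K])).trans
      (pow_le_pow_of_le_one hr0 hr1 (hK z)))
    congr!
  have hfew : binomialExpect E p (fun A => if (#(detourPairs a b A) : ℝ) < M then 1 else 0) ≤
      (m : ℝ) ^ 3 / s ^ 2 := by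
    rw [le_div_iff₀ (by positivity)]
    exact binomialExpect_card_detourPairs_lt_mul_sq_le hp0 hp1 hE ha hb hab hs
  have hsum : ∑ z ∈ (univ : Finset V).offDiag, binomialExpect E p (fun A =>
      if ∀ c ∈ K z, ¬ (s(z.1, c) ∈ A ∧ s(c, z.2) ∈ A) then 1 else 0) ≤
        (Fintype.card V : ℝ) ^ 2 * (1 - p ^ 2) ^ (m - 2) := by
    refine (sum_le_card_nsmul _ _ _ fun z hz => hnbr z (mem_offDiag.mp hz).2.2).trans ?_
    rw [nsmul_eq_mul]
    gcongr
    rw [offDiag_card, ← Nat.cast_pow, Nat.cast_le, card_univ, sq]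
    exact Nat.sub_le _ _
  rw [sub_le_iff_le_add]
  refine le_trans ?_ (add_le_add_right (add_le_add hfew hsum) _)
  rw [← binomialExpect_sum, ← binomialExpect_add, ← binomialExpect_add]
  refine (binomialExpect_const (E := E) (p := p) 1).symm.trans_le ?_
  refine binomialExpect_mono hp0 hp1 fun A _ => ?_
  have hnn (z : V × V) (_ : z ∈ (univ : Finset V).offDiag) :
      (0 : ℝ) ≤ if ∀ c ∈ K z, ¬ (s(z.1, c) ∈ A ∧ s(c, z.2) ∈ A) then 1 else 0 := by
    split_ifs <;> norm_num
  have hnn' := sum_nonneg hnn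
  by_cases h1 : (#(detourPairs a b A) : ℝ) < M
  · rw [if_pos h1, if_neg fun h => absurd h1 (not_lt.mpr h.1)]
    linarith
  · by_cases h2 : ∀ u v, u ≠ v → ∃ k, u ≠ b k ∧ v ≠ b k ∧ s(u, b k) ∈ A ∧ s(b k, v) ∈ A
    · rw [if_neg h1, if_pos ⟨not_lt.mp h1, h2⟩]
      linarith
    · rw [if_neg h1, if_neg fun h => h2 h.2, zero_add, zero_add]
      push Not at h2
      obtain ⟨u, v, huv, h⟩ := h2
      refine le_trans ?_ (single_le_sum hnn (a := (u, v))
        (mem_offDiag.mpr ⟨mem_univ u, mem_univ v, huv⟩))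
      rw [if_pos]
      intro c hc hcA
      simp only [K, mem_sdiff, mem_image, mem_univ, true_and, mem_insert, mem_singleton,
        not_or] at hc
      obtain ⟨⟨k, rfl⟩, h3, h4⟩ := hc
      exact h k (Ne.symm h3) (Ne.symm h4) hcA.1 hcA.2

theorem tendsto_sq_mul_pow_half_sub_two {r : ℝ} (hr0 : 0 ≤ r) (hr1 : r < 1) :
    Filter.Tendsto (fun n : ℕ => (n : ℝ) ^ 2 * r ^ (n / 2 - 2)) Filter.atTop (nhds 0) := by
  have habs : |r| < 1 := by rwa [abs_of_nonneg hr0]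
  have h2 := tendsto_pow_const_mul_const_pow_of_abs_lt_one 2 habs
  have h0 := tendsto_pow_const_mul_const_pow_of_abs_lt_one 0 habs
  have h : Filter.Tendsto (fun k : ℕ => 8 * ((k : ℝ) ^ 2 * r ^ k) + 50 * ((k : ℝ) ^ 0 * r ^ k))
      Filter.atTop (nhds 0) := by
    simpa using (h2.const_mul 8).add (h0.const_mul 50)
  have hk : Filter.Tendsto (fun n : ℕ => n / 2 - 2) Filter.atTop Filter.atTop := by
    refine Filter.tendsto_atTop.mpr fun k => ?_
    filter_upwards [Filter.eventually_ge_atTop (2 * k + 4)] with n hn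
    omega
  refine squeeze_zero (fun n => by positivity) (fun n => ?_) (h.comp hk)
  have hn : (n : ℝ) ≤ 2 * (n / 2 - 2 : ℕ) + 5 := by
    have : n ≤ 2 * (n / 2 - 2) + 5 := by omega
    exact_mod_cast this
  simp only [Function.comp_apply, pow_zero, one_mul]
  generalize n / 2 - 2 = k at hn
  rw [← mul_assoc, ← add_mul]
  refine mul_le_mul_of_nonneg_right ?_ (by positivity)
  have : (0 : ℝ) ≤ n := by positivity
  nlinarith [sq_nonneg (2 * (k : ℝ) - 5)]

end RandomGraph

open Classical in
/-- With probability tending to 1, `G(n,p)` admits at least `2^{(1-ε)(1-p)p²n²/8}`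
neighborly strictly metric path systems. The probability is written out as a weighted sum
over all graphs on `[n]`, identified with the subsets `A` of the set of possible edges,
each graph having probability `p^{|A|}(1-p)^{C(n,2)-|A|}`. -/
theorem gnp_many_neighborly_strictly_metric (p : ℝ) (hp0 : 0 < p) (hp1 : p < 1)
    (ε : ℝ) (hε : 0 < ε) :
    Filter.Tendsto
      (fun n : ℕ =>
        ∑ A ∈ (Finset.univ.filter (fun e : Sym2 (Fin n) => ¬ e.IsDiag)).powerset.filter
            (fun A : Finset (Sym2 (Fin n)) =>
              (2 : ℝ) ^ ((1 - ε) * (1 - p) * p ^ 2 * (n : ℝ) ^ 2 / 8) ≤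
                (Nat.card {P : PathSystem (SimpleGraph.fromEdgeSet (↑A : Set (Sym2 (Fin n)))) //
                  P.Neighborly ∧ P.StrictlyMetric} : ℝ)),
          p ^ A.card *
            (1 - p) ^ ((Finset.univ.filter (fun e : Sym2 (Fin n) => ¬ e.IsDiag)).card - A.card))
      Filter.atTop (nhds 1) := by
  classical
  set q : ℝ := p ^ 2 * (1 - p) with hq
  have hq0 : 0 < q := mul_pos (by positivity) (by linarith)
  set c : ℝ := ε * q / 16 with hc
  have hc0 : 0 < c := by positivity
  have hr0 : 0 ≤ 1 - p ^ 2 := by nlinarith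
  have hr1 : 1 - p ^ 2 < 1 := by nlinarith
  have herr : Filter.Tendsto (fun n : ℕ => 1 - (1 / c ^ 2 * (1 / (n : ℝ)) +
      (n : ℝ) ^ 2 * (1 - p ^ 2) ^ (n / 2 - 2))) Filter.atTop (nhds 1) := by
    have h1 := (tendsto_one_div_atTop_nhds_zero_nat (𝕜 := ℝ)).const_mul (1 / c ^ 2)
    simpa using (h1.add (tendsto_sq_mul_pow_half_sub_two hr0 hr1)).const_sub 1
  have hexpect (n : ℕ) (Q : Finset (Sym2 (Fin n)) → Prop) :
      ∑ A ∈ (Finset.univ.filter (fun e : Sym2 (Fin n) => ¬ e.IsDiag)).powerset.filter Q,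
          p ^ A.card * (1 - p) ^
            ((Finset.univ.filter (fun e : Sym2 (Fin n) => ¬ e.IsDiag)).card - A.card) =
        binomialExpect (Finset.univ.filter (fun e : Sym2 (Fin n) => ¬ e.IsDiag)) p
          (fun A => if Q A then 1 else 0) := by
    rw [binomialExpect, Finset.sum_filter]
    exact Finset.sum_congr rfl fun A _ => by split_ifs <;> simp
  simp only [hexpect]
  refine tendsto_of_tendsto_of_tendsto_of_le_of_le' herr tendsto_const_nhds ?_ ?_
  · filter_upwards [Filter.eventually_ge_atTop 4, Filter.eventually_ge_atTop ⌈8 / ε⌉₊] with n hn hnε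
    have hnε' : 8 ≤ ε * n := by
      rw [← div_le_iff₀' hε]
      exact Nat.ceil_le.mp hnε
    have hn0 : (4 : ℝ) ≤ n := by exact_mod_cast hn
    obtain ⟨m, hm⟩ : ∃ m, m = n / 2 := ⟨_, rfl⟩
    have hmn : (m : ℝ) ≤ n := by
      have : m ≤ n := by omega
      exact_mod_cast this
    have hnm : (n : ℝ) ≤ 2 * m + 1 := by
      have : n ≤ 2 * m + 1 := by omega
      exact_mod_cast this
    let a : Fin m → Fin n := fun i => ⟨i, by omega⟩
    let b : Fin m → Fin n := fun i => ⟨m + i, by omega⟩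
    have ha : Function.Injective a := fun i j h => by
      simp only [a, Fin.mk.injEq] at h
      exact Fin.ext h
    have hb : Function.Injective b := fun i j h => by
      simp only [b, Fin.mk.injEq] at h
      exact Fin.ext (by omega)
    have hab (i j : Fin m) : a i ≠ b j := fun h => by
      simp only [a, b, Fin.mk.injEq] at h
      omega
    have hs : 0 < c * (n : ℝ) ^ 2 := by positivity
    have hgood := one_sub_le_binomialExpect_good
      (E := Finset.univ.filter (fun e : Sym2 (Fin n) => ¬ e.IsDiag))
      hp0.le hp1.le (fun x y hxy => by simpa using hxy) ha hb hab hs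
    rw [← hm]
    refine le_trans ?_ (hgood.trans ?_)
    · rw [Fintype.card_fin]
      have h1 : (m : ℝ) ^ 3 / (c * (n : ℝ) ^ 2) ^ 2 ≤ 1 / c ^ 2 * (1 / (n : ℝ)) := by
        calc (m : ℝ) ^ 3 / (c * (n : ℝ) ^ 2) ^ 2 ≤ (n : ℝ) ^ 3 / (c * (n : ℝ) ^ 2) ^ 2 := by gcongr
          _ = _ := by field_simp
      linarith
    · refine binomialExpect_mono hp0.le hp1.le fun A _ => ?_
      split_ifs with h1 h2 h2
      · exact le_rfl
      · refine absurd ?_ h2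
        have hcard := two_pow_card_detourPairs_le ha hb hab A h1.2
        refine le_trans ?_ (Nat.cast_le.mpr hcard)
        rw [Nat.cast_pow, Nat.cast_ofNat, ← Real.rpow_natCast (2 : ℝ)]
        refine Real.rpow_le_rpow_of_exponent_le one_le_two (le_trans ?_ h1.1)
        have hM := two_mul_card_filter_fst_lt_snd m
        generalize (Finset.univ.filter fun t : Fin m × Fin m => t.1 < t.2).card = M at hM
        have hM' : 2 * (M : ℝ) + m = (m : ℝ) ^ 2 := by exact_mod_cast hM
        have hM8 : (n : ℝ) ^ 2 - 4 * n ≤ 8 * M := by nlinarith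
        have key : (1 - ε) * n ^ 2 / 8 ≤ M - ε * n ^ 2 / 16 := by nlinarith
        have := mul_le_mul_of_nonneg_left key hq0.le
        rw [hc]
        calc _ = q * ((1 - ε) * n ^ 2 / 8) := by rw [hq]; ring
          _ ≤ q * (M - ε * n ^ 2 / 16) := this
          _ = _ := by ring
      · norm_num
      · exact le_rfl
  · refine Filter.Eventually.of_forall fun n => ?_
    refine (binomialExpect_mono hp0.le hp1.le (g := fun _ => 1) fun A _ => ?_).trans_eq
      (binomialExpect_const 1)
    split_ifs <;> norm_num
end

section
/- For every ε > 0 there exists N such that for all n ≥ N, the number of distinct sets of the form T(ρ), as ρ ranges over all pseudometrics on [n], is at most 2^{(2.38+ε)n²}. (Equivalently, the metric cone MET_n has at most 2^{2.38n²(1+o(1))} faces.) -/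
open SimpleGraph

/-- A pointed triple `{a,b;c}` on `[n]`: an unordered pair `{a,b}` of distinct vertices
together with a distinguished third vertex `c ∉ {a,b}`. -/
abbrev PointedTriple (n : ℕ) :=
  {p : Sym2 (Fin n) × Fin n // ¬ p.1.IsDiag ∧ p.2 ∉ p.1}

/-- `ρ` is a pseudometric on `Fin n`. -/
def IsPseudometric {n : ℕ} (ρ : Fin n → Fin n → ℝ) : Prop :=
  (∀ x, ρ x x = 0) ∧ (∀ x y, ρ x y = ρ y x) ∧ ∀ x y z, ρ x z ≤ ρ x y + ρ y z

/-- `ρ` is a metric on `Fin n`. -/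
def IsMetric {n : ℕ} (ρ : Fin n → Fin n → ℝ) : Prop :=
  IsPseudometric ρ ∧ ∀ x y : Fin n, x ≠ y → 0 < ρ x y

/-- `T(ρ)`: the set of pointed triples `{a,b;c}` that are colinear w.r.t. `ρ`, i.e.
`ρ(a,b) = ρ(a,c) + ρ(c,b)`. -/
def Tpm {n : ℕ} (ρ : Fin n → Fin n → ℝ) : Set (PointedTriple n) :=
  {t | ∃ a b : Fin n, t.val.1 = s(a, b) ∧ ρ a b = ρ a t.val.2 + ρ t.val.2 b}

open Module in
/-- The relations `φ (r t) = φ (p t) + φ (q t)` indexed by `t ∈ F` are implied by at most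
`card E` of them. -/
theorem exists_finset_generating_relations {ι E : Type*} [Finite ι] [Fintype E]
    (p q r : ι → E) (F : Set ι) :
    ∃ S : Finset ι, (∀ t ∈ S, t ∈ F) ∧ S.card ≤ Fintype.card E ∧
      ∀ φ : E → ℝ, (∀ t ∈ S, φ (r t) = φ (p t) + φ (q t)) →
        ∀ t ∈ F, φ (r t) = φ (p t) + φ (q t) := by
  classical
  have := Fintype.ofFinite ι
  let v : ι → Dual ℝ (E → ℝ) := fun t =>
    let ev : E → Dual ℝ (E → ℝ) := LinearMap.proj
    ev (p t) + ev (q t) - ev (r t)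
  have hv : ∀ t φ, v t φ = 0 ↔ φ (r t) = φ (p t) + φ (q t) := fun t φ => by
    simp only [v, LinearMap.sub_apply, LinearMap.add_apply, LinearMap.proj_apply, sub_eq_zero]
    exact eq_comm
  obtain ⟨S, hSF, -, hspan, hli⟩ := exists_linearIndepOn_extension
    (linearIndepOn_empty ℝ v) (Set.empty_subset F)
  refine ⟨S.toFinset, fun t ht => hSF (Set.mem_toFinset.1 ht), ?_, fun φ hφ t ht => ?_⟩
  · have h := LinearIndependent.fintype_card_le_finrank hli
    rwa [Subspace.dual_finrank_eq, finrank_fintype_fun_eq_card, ← Set.toFinset_card] at h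
  · have hle : Submodule.span ℝ (v '' S) ≤ LinearMap.ker (Dual.eval ℝ (E → ℝ) φ) := by
      rw [Submodule.span_le]
      rintro _ ⟨s, hs, rfl⟩
      exact (hv s φ).2 (hφ s (Set.mem_toFinset.2 hs))
    exact (hv t φ).1 (hle (hspan ⟨t, ht, rfl⟩))

/-- Enlarge a multiset to a prescribed cardinality `k` by adding copies of `none`. -/
def Multiset.padTo {E : Type*} (k : ℕ) (m : Multiset E) (h : m.card ≤ k) : Sym (Option E) k :=
  ⟨m.map some + Multiset.replicate (k - m.card) none, by simp; omega⟩

theorem Multiset.sum_map_elim_padTo {E : Type*} {k : ℕ} (m : Multiset E) (h : m.card ≤ k)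
    (φ : E → ℝ) :
    ((m.padTo k h : Multiset (Option E)).map fun x => x.elim 0 φ).sum = (m.map φ).sum := by
  change ((m.map some + Multiset.replicate (k - m.card) none).map _).sum = _
  simp [Multiset.map_map, Function.comp_def]

theorem choose_three_mul_mul_choose_two_mul_le (m : ℕ) :
    (3 * m).choose (2 * m) * (2 * m).choose m ≤ 27 ^ m := by
  have h₁ : (2 * m).choose m ≤ 2 ^ (2 * m) := Nat.choose_le_two_pow _ _
  have h₂ : 2 ^ (2 * m) * (3 * m).choose (2 * m) ≤ 27 ^ m := by
    have h := add_pow 2 1 (3 * m)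
    calc 2 ^ (2 * m) * (3 * m).choose (2 * m)
        = 2 ^ (2 * m) * 1 ^ (3 * m - 2 * m) * (3 * m).choose (2 * m) := by simp
      _ ≤ ∑ i ∈ Finset.range (3 * m + 1), 2 ^ i * 1 ^ (3 * m - i) * (3 * m).choose i :=
          Finset.single_le_sum
            (f := fun i => 2 ^ i * 1 ^ (3 * m - i) * (3 * m).choose i)
            (fun _ _ => Nat.zero_le _) (Finset.mem_range.2 (by omega))
      _ = (2 + 1) ^ (3 * m) := h.symm
      _ = 27 ^ m := by rw [pow_mul]; norm_num
  calc _ ≤ (3 * m).choose (2 * m) * 2 ^ (2 * m) := Nat.mul_le_mul_left _ h₁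
    _ ≤ 27 ^ m := by rwa [mul_comm]

/-- Among the solutions `φ` of a system of inequalities `φ (r t) ≤ φ (p t) + φ (q t)` in
`card E` unknowns, at most `27 ^ card E` different sets of inequalities can be tight. -/
theorem card_tight_sets_le {ι E : Type*} [Finite ι] [Fintype E] (p q r : ι → E)
    (P : Set ι → Prop)
    (hP : ∀ F, P F → ∃ φ : E → ℝ, (∀ t, φ (r t) ≤ φ (p t) + φ (q t)) ∧
      ∀ t, t ∈ F ↔ φ (r t) = φ (p t) + φ (q t)) :
    Nat.card {F : Set ι // P F} ≤ 27 ^ Fintype.card E := by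
  classical
  set m := Fintype.card E with hm
  choose S hSF hcard hgen using exists_finset_generating_relations p q r
  let U : Set ι → Multiset E := fun F => (S F).val.map p + (S F).val.map q
  let W : Set ι → Multiset E := fun F => (S F).val.map r
  have hU : ∀ F, (U F).card ≤ 2 * m := fun F => by
    have := hcard F
    simp only [U, Multiset.card_add, Multiset.card_map, Finset.card_val]
    omega
  have hW : ∀ F, (W F).card ≤ m := fun F => by
    simpa only [W, Multiset.card_map, Finset.card_val] using hcard F
  let code : {F : Set ι // P F} → Sym (Option E) (2 * m) × Sym (Option E) m :=
    fun F => ((U F).padTo _ (hU F), (W F).padTo _ (hW F))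
  have hsub : ∀ F G : {F : Set ι // P F}, code F = code G → (G : Set ι) ⊆ F := by
    intro F G hFG t ht
    obtain ⟨φ, hφ, hF⟩ := hP F F.2
    have hUeq : ((U F).map φ).sum = ((U G).map φ).sum := by
      rw [← Multiset.sum_map_elim_padTo _ (hU F), ← Multiset.sum_map_elim_padTo _ (hU G)]
      rw [show (U F).padTo _ (hU F) = (U G).padTo _ (hU G) from congrArg Prod.fst hFG]
    have hWeq : ((W F).map φ).sum = ((W G).map φ).sum := by
      rw [← Multiset.sum_map_elim_padTo _ (hW F), ← Multiset.sum_map_elim_padTo _ (hW G)]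
      rw [show (W F).padTo _ (hW F) = (W G).padTo _ (hW G) from congrArg Prod.snd hFG]
    have hUsum : ∀ A, ((U A).map φ).sum = ∑ t ∈ S A, (φ (p t) + φ (q t)) := fun A => by
      rw [Finset.sum_add_distrib]
      simp [U]
    have hWsum : ∀ A, ((W A).map φ).sum = ∑ t ∈ S A, φ (r t) := fun A => by
      simp [W]
    have hFsum : ∑ t ∈ S F, φ (r t) = ∑ t ∈ S F, (φ (p t) + φ (q t)) :=
      Finset.sum_congr rfl fun t ht => (hF t).1 (hSF F t ht)
    have hGsum : ∑ t ∈ S G, φ (r t) = ∑ t ∈ S G, (φ (p t) + φ (q t)) := by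
      rw [← hUsum, ← hWsum, ← hUeq, ← hWeq, hUsum, hWsum, hFsum]
    exact (hF t).2 (hgen G φ
      ((Finset.sum_eq_sum_iff_of_le fun t _ => hφ t).1 hGsum) t ht)
  have hinj : Function.Injective code := fun F G h =>
    Subtype.ext ((hsub G F h.symm).antisymm (hsub F G h))
  calc Nat.card {F : Set ι // P F}
      ≤ Nat.card (Sym (Option E) (2 * m) × Sym (Option E) m) :=
        Nat.card_le_card_of_injective code hinj
    _ = (3 * m).choose (2 * m) * (2 * m).choose m := by
        rw [Nat.card_eq_fintype_card, Fintype.card_prod, Sym.card_sym_eq_choose,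
          Sym.card_sym_eq_choose, Fintype.card_option, ← hm]
        congr 2 <;> omega
    _ ≤ 27 ^ m := choose_three_mul_mul_choose_two_mul_le m

theorem card_Tpm_le (n : ℕ) :
    Nat.card {F : Set (PointedTriple n) //
      ∃ ρ : Fin n → Fin n → ℝ, IsPseudometric ρ ∧ Tpm ρ = F} ≤ 27 ^ (n + 1).choose 2 := by
  have hout : ∀ t : PointedTriple n, s((Quot.out t.1.1).1, (Quot.out t.1.1).2) = t.1.1 :=
    fun t => Quot.out_eq t.1.1
  have h := card_tight_sets_le
    (fun t : PointedTriple n => s((Quot.out t.1.1).1, t.1.2))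
    (fun t => s(t.1.2, (Quot.out t.1.1).2)) (fun t => t.1.1)
    (fun F => ∃ ρ : Fin n → Fin n → ℝ, IsPseudometric ρ ∧ Tpm ρ = F) ?_
  · rwa [Sym2.card, Fintype.card_fin] at h
  rintro _ ⟨ρ, ⟨-, hsymm, htri⟩, rfl⟩
  have hlift : ∀ t : PointedTriple n, Sym2.lift ⟨ρ, hsymm⟩ t.1.1 =
      ρ (Quot.out t.1.1).1 (Quot.out t.1.1).2 := fun t => by
    conv_lhs => rw [← hout t]
    rfl
  refine ⟨Sym2.lift ⟨ρ, hsymm⟩, fun t => ?_, fun t => ?_⟩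
  · rw [hlift, Sym2.lift_mk, Sym2.lift_mk]
    exact htri _ _ _
  · rw [hlift, Sym2.lift_mk, Sym2.lift_mk]
    constructor
    · rintro ⟨a, b, hab, h⟩
      rcases Sym2.eq_iff.1 ((hout t).trans hab) with ⟨h₁, h₂⟩ | ⟨h₁, h₂⟩
      · rw [h₁, h₂]
        exact h
      · rw [h₁, h₂]
        change ρ b a = ρ b _ + ρ _ a
        rw [hsymm b a, h, hsymm b, hsymm _ a, add_comm]
    · exact fun h => ⟨_, _, (hout t).symm, h⟩

theorem count_colinearity_patterns_upper :
    ∀ ε : ℝ, 0 < ε → ∃ N : ℕ, ∀ n : ℕ, N ≤ n →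
      (Nat.card {F : Set (PointedTriple n) //
          ∃ ρ : Fin n → Fin n → ℝ, IsPseudometric ρ ∧ Tpm ρ = F} : ℝ) ≤
        (2 : ℝ) ^ ((2.38 + ε) * (n : ℝ) ^ 2) := by
  intro ε hε
  refine ⟨⌈2.38 / ε⌉₊, fun n hn => ?_⟩
  have hn' : 2.38 ≤ n * ε := (div_le_iff₀ hε).1 (Nat.ceil_le.1 hn)
  have h27 : (27 : ℝ) ≤ 2 ^ (4.76 : ℝ) := by
    have h : (27 : ℝ) ^ 25 ≤ ((2 : ℝ) ^ (4.76 : ℝ)) ^ 25 := by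
      rw [← Real.rpow_natCast (2 ^ (4.76 : ℝ)), ← Real.rpow_mul (by norm_num),
        show (4.76 : ℝ) * (25 : ℕ) = (119 : ℕ) by norm_num, Real.rpow_natCast]
      norm_num
    exact le_of_pow_le_pow_left₀ (by norm_num) (by positivity) h
  have hchoose : (((n + 1).choose 2 : ℕ) : ℝ) = (n + 1) * n / 2 := by
    rw [Nat.cast_choose_two]
    push_cast
    ring
  calc (Nat.card {F : Set (PointedTriple n) //
          ∃ ρ : Fin n → Fin n → ℝ, IsPseudometric ρ ∧ Tpm ρ = F} : ℝ)
      ≤ (27 : ℝ) ^ (n + 1).choose 2 := by exact_mod_cast card_Tpm_le n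
    _ ≤ ((2 : ℝ) ^ (4.76 : ℝ)) ^ (n + 1).choose 2 := by gcongr
    _ = (2 : ℝ) ^ (4.76 * ((n + 1) * n / 2) : ℝ) := by
        rw [← Real.rpow_natCast, ← Real.rpow_mul (by norm_num), hchoose]
    _ ≤ (2 : ℝ) ^ ((2.38 + ε) * (n : ℝ) ^ 2) := by
        refine Real.rpow_le_rpow_of_exponent_le (by norm_num) ?_
        nlinarith [mul_le_mul_of_nonneg_right hn' n.cast_nonneg]
end

section
/- Let S and S̃ be sets of pointed triples on [n] with σ(S) = σ(S̃), where σ(S) := Σ_{t ∈ S} Δ_t. Then cl(S) = cl(S̃), where for a set S of pointed triples, cl(S) denotes the intersection of all sets F ∈ 𝓕 with S ⊆ F, and 𝓕 := {T(ρ) : ρ is a pseudometric on [n]}. -/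
open SimpleGraph

/-- The standard basis vector `e_{x,y}` of the coordinate indexed by the unordered pair
`{x,y}`. -/
def eVec {n : ℕ} (x y : Fin n) : Sym2 (Fin n) → ℝ :=
  fun e => if e = s(x, y) then 1 else 0

lemma eVec_comm {n : ℕ} (x y : Fin n) : eVec x y = eVec y x := by
  funext e
  unfold eVec
  rw [Sym2.eq_swap]

/-- `Δ` for the ordered triple `(a,b,c)`: `e_{a,c} + e_{c,b} - e_{a,b}`. -/
def DeltaO {n : ℕ} (a b c : Fin n) : Sym2 (Fin n) → ℝ :=
  eVec a c + eVec c b - eVec a b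

lemma DeltaO_comm {n : ℕ} (a b c : Fin n) : DeltaO a b c = DeltaO b a c := by
  unfold DeltaO
  rw [eVec_comm a c, eVec_comm c b, eVec_comm a b]
  abel

/-- `Δ` for the pair `e = {a,b}` pointed at `c`. -/
def DeltaS {n : ℕ} (e : Sym2 (Fin n)) (c : Fin n) : Sym2 (Fin n) → ℝ :=
  Sym2.lift ⟨fun a b => DeltaO a b c, fun a b => DeltaO_comm a b c⟩ e

/-- `Δ_t` for a pointed triple `t = {a,b;c}`: the vector `e_{a,c} + e_{c,b} - e_{a,b}`. -/
def Delta {n : ℕ} (t : PointedTriple n) : Sym2 (Fin n) → ℝ :=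
  DeltaS t.val.1 t.val.2

noncomputable instance (n : ℕ) : Fintype (PointedTriple n) := Fintype.ofFinite _

/-- The closure of a set `S` of pointed triples: the intersection of all sets of the form
`T(ρ)`, `ρ` a pseudometric, containing `S`. -/
def clS {n : ℕ} (S : Set (PointedTriple n)) : Set (PointedTriple n) :=
  ⋂₀ {F : Set (PointedTriple n) |
    (∃ ρ : Fin n → Fin n → ℝ, IsPseudometric ρ ∧ Tpm ρ = F) ∧ S ⊆ F}

/-- The linear functional on `Sym2 (Fin n) → ℝ` given by pairing with a symmetric function `ρ`. -/
noncomputable def pairing {n : ℕ} (ρ : Fin n → Fin n → ℝ) (hs : ∀ x y, ρ x y = ρ y x) :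
    (Sym2 (Fin n) → ℝ) →ₗ[ℝ] ℝ :=
  Fintype.linearCombination ℝ (Sym2.lift ⟨ρ, hs⟩)

lemma pairing_eVec {n : ℕ} (ρ : Fin n → Fin n → ℝ) (hs : ∀ x y, ρ x y = ρ y x) (x y : Fin n) :
    pairing ρ hs (eVec x y) = ρ x y := by
  simp [pairing, Fintype.linearCombination_apply, eVec]

lemma pairing_DeltaO {n : ℕ} (ρ : Fin n → Fin n → ℝ) (hs : ∀ x y, ρ x y = ρ y x)
    (a b c : Fin n) : pairing ρ hs (DeltaO a b c) = ρ a c + ρ c b - ρ a b := by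
  simp [DeltaO, pairing_eVec]

lemma pairing_Delta_nonneg {n : ℕ} {ρ : Fin n → Fin n → ℝ} (hρ : IsPseudometric ρ)
    (t : PointedTriple n) : 0 ≤ pairing ρ hρ.2.1 (Delta t) := by
  obtain ⟨⟨e, c⟩, ht⟩ := t
  induction e using Sym2.ind with
  | _ a b =>
    change 0 ≤ pairing ρ hρ.2.1 (DeltaO a b c)
    rw [pairing_DeltaO]
    linarith [hρ.2.2 a c b]

lemma mem_Tpm_iff_pairing_Delta {n : ℕ} {ρ : Fin n → Fin n → ℝ} (hs : ∀ x y, ρ x y = ρ y x)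
    (t : PointedTriple n) : t ∈ Tpm ρ ↔ pairing ρ hs (Delta t) = 0 := by
  have key : ∀ a b : Fin n, t.val.1 = s(a, b) →
      pairing ρ hs (Delta t) = ρ a t.val.2 + ρ t.val.2 b - ρ a b := fun a b hab => by
    rw [Delta, hab]
    exact pairing_DeltaO ρ hs a b t.val.2
  constructor
  · rintro ⟨a, b, hab, h⟩
    rw [key a b hab, h, sub_self]
  · intro h
    obtain ⟨a, b, hab⟩ : ∃ a b, t.val.1 = s(a, b) := by
      induction t.val.1 using Sym2.ind with
      | _ a b => exact ⟨a, b, rfl⟩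
    rw [key a b hab] at h
    exact ⟨a, b, hab, by linarith⟩

/-- A face `T(ρ)` contains `S` exactly when `ρ` pairs to zero with the signature of `S`. -/
lemma subset_Tpm_iff_pairing_sum {n : ℕ} {ρ : Fin n → Fin n → ℝ} (hρ : IsPseudometric ρ)
    (S : Finset (PointedTriple n)) :
    (↑S : Set (PointedTriple n)) ⊆ Tpm ρ ↔ pairing ρ hρ.2.1 (∑ t ∈ S, Delta t) = 0 := by
  rw [map_sum, Finset.sum_eq_zero_iff_of_nonneg fun t _ => pairing_Delta_nonneg hρ t]
  exact forall₂_congr fun t _ => mem_Tpm_iff_pairing_Delta hρ.2.1 t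

theorem signature_determines_closure (n : ℕ) (S S' : Finset (PointedTriple n))
    (h : ∑ t ∈ S, Delta t = ∑ t ∈ S', Delta t) :
    clS (↑S : Set (PointedTriple n)) = clS (↑S' : Set (PointedTriple n)) := by
  unfold clS
  congr 1
  ext F
  refine and_congr_right ?_
  rintro ⟨ρ, hρ, rfl⟩
  rw [subset_Tpm_iff_pairing_sum hρ, subset_Tpm_iff_pairing_sum hρ, h]
end

section
/- For every m ≥ 1, the complete bipartite graph K_{m,m} with parts of size m admits at least 2^{m(m−1)/2} neighborly strictly metric path systems. -/
open SimpleGraph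

namespace PathSystem

section General

variable {V : Type*} {G : SimpleGraph V}

theorem wlen_cons (w : Sym2 V → ℝ) {u v x : V} (h : G.Adj u v) (Q : G.Walk v x) :
    wlen w (Walk.cons h Q) = w s(u, v) + wlen w Q := by
  simp [wlen]

theorem wlen_reverse (w : Sym2 V → ℝ) {u v : V} (Q : G.Walk u v) :
    wlen w Q.reverse = wlen w Q := by
  simp [wlen]

theorem mul_length_le_wlen {w : Sym2 V → ℝ} {c : ℝ} (hw : ∀ e ∈ G.edgeSet, c ≤ w e)
    {u v : V} (Q : G.Walk u v) : c * Q.length ≤ wlen w Q := by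
  induction Q with
  | nil => simp [wlen]
  | cons h Q ih =>
    have := hw _ ((G.mem_edgeSet).2 h)
    rw [wlen_cons, Walk.length_cons]
    push_cast
    linarith

/-- The path `p` is strictly `w`-shorter than every other path with the same endpoints. -/
def UniqueShortest (w : Sym2 V → ℝ) {u v : V} (p : G.Path u v) : Prop :=
  ∀ Q : G.Path u v, Q ≠ p → wlen w p.val < wlen w Q.val

theorem UniqueShortest.eq {w : Sym2 V → ℝ} {u v : V} {p q : G.Path u v}
    (hp : UniqueShortest w p) (hq : UniqueShortest w q) : p = q := by
  by_contra h
  exact lt_asymm (hp q (Ne.symm h)) (hq p h)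

theorem UniqueShortest.reverse {w : Sym2 V → ℝ} {u v : V} {p : G.Path u v}
    (hp : UniqueShortest w p) : UniqueShortest w p.reverse := by
  intro Q hQ
  have h := hp Q.reverse (by
    rintro rfl
    exact hQ (Subtype.ext (by simp [Path.reverse])))
  simpa [Path.reverse, wlen_reverse] using h

theorem exists_forall_uniqueShortest {w : Sym2 V → ℝ}
    (h : ∀ u v : V, u ≠ v → ∃ p : G.Path u v, UniqueShortest w p) :
    ∃ P : PathSystem G, ∀ u v huv, UniqueShortest w (P.path u v huv) := by
  choose p hp using h
  refine ⟨⟨p, fun u v huv => ?_⟩, hp⟩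
  rw [(hp v u huv.symm).eq (hp u v huv).reverse]
  rfl

instance [Finite V] : Finite (PathSystem G) := by
  classical
  have := Fintype.ofFinite V
  have (u v : V) : Finite (G.Path u v) := by
    refine Finite.of_injective
      (fun p : G.Path u v => (⟨p.val.support, p.property.support_nodup⟩ : {l : List V // l.Nodup}))
      fun p q h => Subtype.ext (Walk.ext_support (congrArg Subtype.val h))
  refine Finite.of_injective (fun P : PathSystem G => P.path) ?_
  rintro ⟨p, _⟩ ⟨q, _⟩ h
  cases h
  rfl

end General

section Bipartite

variable {α : Type*} {T : α → α → Prop}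

open Classical in
/-- The weight of the edge joining `inl i` and `inr j`, for a tournament `T`. -/
noncomputable def tournamentCost (T : α → α → Prop) (i j : α) : ℝ :=
  if i = j then 5 else if T i j then 6 else 7

/-- The edge weights on the complete bipartite graph attached to a tournament `T`. -/
noncomputable def tournamentWeight (T : α → α → Prop) : Sym2 (α ⊕ α) → ℝ :=
  Sym2.lift ⟨fun
    | .inl i, .inr j => tournamentCost T i j
    | .inr j, .inl i => tournamentCost T i j
    | _, _ => 0, by rintro (i | i) (j | j) <;> rfl⟩

@[simp] theorem tournamentWeight_inl_inr (i j : α) :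
    tournamentWeight T s(.inl i, .inr j) = tournamentCost T i j := rfl

@[simp] theorem tournamentWeight_inr_inl (i j : α) :
    tournamentWeight T s(.inr j, .inl i) = tournamentCost T i j := rfl

theorem five_le_tournamentCost (i j : α) : 5 ≤ tournamentCost T i j := by
  unfold tournamentCost
  split_ifs <;> norm_num

theorem tournamentCost_le_seven (i j : α) : tournamentCost T i j ≤ 7 := by
  unfold tournamentCost
  split_ifs <;> norm_num

theorem six_le_tournamentCost {i j : α} (h : i ≠ j) : 6 ≤ tournamentCost T i j := by
  rw [tournamentCost, if_neg h]
  split_ifs <;> norm_num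

theorem tournamentCost_self (i : α) : tournamentCost T i i = 5 := if_pos rfl

theorem tournamentCost_of_rel {i j : α} (h : i ≠ j) (hT : T i j) :
    tournamentCost T i j = 6 := by
  rw [tournamentCost, if_neg h, if_pos hT]

theorem tournamentCost_of_not_rel {i j : α} (h : i ≠ j) (hT : ¬ T i j) :
    tournamentCost T i j = 7 := by
  rw [tournamentCost, if_neg h, if_neg hT]

theorem five_le_tournamentWeight :
    ∀ e ∈ (completeBipartiteGraph α α).edgeSet, 5 ≤ tournamentWeight T e := by
  intro e
  induction e with | _ u v =>
  rcases u with i | i <;> rcases v with j | j <;> simp [five_le_tournamentCost]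

theorem five_mul_length_le {u v : α ⊕ α} (Q : (completeBipartiteGraph α α).Walk u v) :
    5 * (Q.length : ℝ) ≤ wlen (tournamentWeight T) Q :=
  mul_length_le_wlen five_le_tournamentWeight Q

theorem tournamentWeight_le_seven (u v : α ⊕ α) : tournamentWeight T s(u, v) ≤ 7 := by
  rcases u with i | i <;> rcases v with j | j
  · simp [tournamentWeight]
  · exact tournamentCost_le_seven i j
  · exact tournamentCost_le_seven j i
  · simp [tournamentWeight]

theorem uniqueShortest_edge {u v : α ⊕ α} (h : (completeBipartiteGraph α α).Adj u v) :
    UniqueShortest (tournamentWeight T) (SimpleGraph.Path.singleton h) := by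
  rintro ⟨Q, hQ⟩ hne
  have h7 := tournamentWeight_le_seven (T := T) u v
  have hlen := five_mul_length_le (T := T) Q
  have hsing : wlen (tournamentWeight T) (SimpleGraph.Path.singleton h).val = tournamentWeight T s(u, v) := by
    simp [SimpleGraph.Path.singleton, wlen]
  rw [hsing]
  cases Q with
  | nil => exact absurd rfl h.ne
  | cons h' Q =>
    cases Q with
    | nil => exact absurd rfl hne
    | cons h'' Q =>
      simp only [Walk.length_cons] at hlen
      push_cast at hlen
      have : (0 : ℝ) ≤ Q.length := Nat.cast_nonneg _
      linarith

/-- The path of length two between two vertices of the left part. -/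
def leftPath {i j : α} (h : i ≠ j) (k : α) :
    (completeBipartiteGraph α α).Path (.inl i) (.inl j) :=
  ⟨.cons (v := .inr k) (by simp) (.cons (by simp) .nil), by simp [Walk.isPath_def, h]⟩

/-- The path of length two between two vertices of the right part. -/
def rightPath {i j : α} (h : i ≠ j) (k : α) :
    (completeBipartiteGraph α α).Path (.inr i) (.inr j) :=
  ⟨.cons (v := .inl k) (by simp) (.cons (by simp) .nil), by simp [Walk.isPath_def, h]⟩

theorem wlen_leftPath {i j : α} (h : i ≠ j) (k : α) :
    wlen (tournamentWeight T) (leftPath h k).val = tournamentCost T i k + tournamentCost T j k := by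
  simp [leftPath, wlen]

theorem wlen_rightPath {i j : α} (h : i ≠ j) (k : α) :
    wlen (tournamentWeight T) (rightPath h k).val =
      tournamentCost T k i + tournamentCost T k j := by
  simp [rightPath, wlen]

theorem uniqueShortest_leftPath {i j : α} (h : i ≠ j) (hij : T i j) (hji : ¬ T j i) :
    UniqueShortest (tournamentWeight T) (leftPath h j) := by
  rintro ⟨Q, hQ⟩ hne
  have hlen := five_mul_length_le (T := T) Q
  rw [wlen_leftPath, tournamentCost_of_rel h hij, tournamentCost_self]
  rcases Q with _ | @⟨_, k | k, _, h₁, _ | ⟨h₂, _ | ⟨h₃, Q⟩⟩⟩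
  · exact absurd rfl h
  · simp at h₁
  · simp at h₁
  · simp at h₁
  · have hk : k ≠ j := by
      rintro rfl
      exact hne rfl
    change _ < wlen _ (leftPath h k).val
    rw [wlen_leftPath]
    by_cases hki : k = i
    · subst hki
      rw [tournamentCost_self, tournamentCost_of_not_rel h.symm hji]
      norm_num
    · have h₁ := six_le_tournamentCost (T := T) (Ne.symm hki)
      have h₂ := six_le_tournamentCost (T := T) (Ne.symm hk)
      linarith
  · simp only [Walk.length_cons] at hlen
    push_cast at hlen
    have : (0 : ℝ) ≤ Q.length := Nat.cast_nonneg _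
    linarith

theorem uniqueShortest_rightPath {i j : α} (h : i ≠ j) (hij : T i j) (hji : ¬ T j i) :
    UniqueShortest (tournamentWeight T) (rightPath h i) := by
  rintro ⟨Q, hQ⟩ hne
  have hlen := five_mul_length_le (T := T) Q
  rw [wlen_rightPath, tournamentCost_of_rel h hij, tournamentCost_self]
  rcases Q with _ | @⟨_, k | k, _, h₁, _ | ⟨h₂, _ | ⟨h₃, Q⟩⟩⟩
  · exact absurd rfl h
  · have hk : k ≠ i := by
      rintro rfl
      exact hne rfl
    change _ < wlen _ (rightPath h k).val
    rw [wlen_rightPath]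
    by_cases hkj : k = j
    · subst hkj
      rw [tournamentCost_self, tournamentCost_of_not_rel h.symm hji]
      norm_num
    · have h₁ := six_le_tournamentCost (T := T) hk
      have h₂ := six_le_tournamentCost (T := T) hkj
      linarith
  · simp only [Walk.length_cons] at hlen
    push_cast at hlen
    have : (0 : ℝ) ≤ Q.length := Nat.cast_nonneg _
    linarith
  · simp at h₁
  · simp at h₁
  · simp at h₁

/-- Every tournament on `α` is encoded by a neighborly strictly metric path system. -/
theorem exists_pathSystem_of_tournament (hT : ∀ i j, i ≠ j → (T i j ↔ ¬ T j i)) :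
    ∃ P : PathSystem (completeBipartiteGraph α α), (P.Neighborly ∧ P.StrictlyMetric) ∧
      ∀ i j (h : i ≠ j),
        .inr j ∈ (P.path (.inl i) (.inl j) (Sum.inl_injective.ne h)).val.support ↔ T i j := by
  obtain ⟨P, hP⟩ := exists_forall_uniqueShortest (G := completeBipartiteGraph α α)
    (w := tournamentWeight T) (by
      rintro (i | i) (j | j) huv
      · have h : i ≠ j := fun h => huv (congrArg _ h)
        by_cases hij : T i j
        · exact ⟨_, uniqueShortest_leftPath h hij ((hT i j h).1 hij)⟩
        · exact ⟨_, (uniqueShortest_leftPath h.symm ((hT j i h.symm).2 hij) hij).reverse⟩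
      · exact ⟨_, uniqueShortest_edge (by simp)⟩
      · exact ⟨_, uniqueShortest_edge (by simp)⟩
      · have h : i ≠ j := fun h => huv (congrArg _ h)
        by_cases hij : T i j
        · exact ⟨_, uniqueShortest_rightPath h hij ((hT i j h).1 hij)⟩
        · exact ⟨_, (uniqueShortest_rightPath h.symm ((hT j i h.symm).2 hij) hij).reverse⟩)
  refine ⟨P, ⟨fun u v h => ?_, tournamentWeight T, fun e he => ?_, hP⟩, fun i j h => ?_⟩
  · rw [(hP u v h.ne).eq (uniqueShortest_edge h)]
    rfl
  · linarith [five_le_tournamentWeight (T := T) e he]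
  · by_cases hij : T i j
    · rw [(hP _ _ _).eq (uniqueShortest_leftPath h hij ((hT i j h).1 hij))]
      simp [leftPath, hij]
    · rw [(hP _ _ _).eq (uniqueShortest_leftPath h.symm ((hT j i h.symm).2 hij) hij).reverse]
      simp [leftPath, Path.reverse, hij, h.symm]

end Bipartite

/-- The tournament on `Fin m` whose arc between `i` and `j < i` is directed by `s i j`. -/
def orient {m : ℕ} (s : (i : Fin m) → Fin i → Bool) (i j : Fin m) : Prop :=
  (∃ h : j < i, s i ⟨j, h⟩ = true) ∨ ∃ h : i < j, s j ⟨i, h⟩ = false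

theorem orient_of_lt {m : ℕ} (s : (i : Fin m) → Fin i → Bool) {i j : Fin m} (h : j < i) :
    orient s i j ↔ s i ⟨j, h⟩ = true := by
  simp [orient, h, h.not_gt]

theorem orient_of_gt {m : ℕ} (s : (i : Fin m) → Fin i → Bool) {i j : Fin m} (h : i < j) :
    orient s i j ↔ s j ⟨i, h⟩ = false := by
  simp [orient, h, h.not_gt]

theorem orient_iff_not {m : ℕ} (s : (i : Fin m) → Fin i → Bool) (i j : Fin m) (h : i ≠ j) :
    orient s i j ↔ ¬ orient s j i := by
  rcases lt_or_gt_of_ne h with h | h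
  · simp [orient_of_lt s h, orient_of_gt s h]
  · simp [orient_of_lt s h, orient_of_gt s h]

end PathSystem

open PathSystem in
theorem complete_bipartite_many_strictly_metric (m : ℕ) (hm : 1 ≤ m) :
    2 ^ (m * (m - 1) / 2) ≤
      Nat.card {P : PathSystem (completeBipartiteGraph (Fin m) (Fin m)) //
        P.Neighborly ∧ P.StrictlyMetric} := by
  choose F hF hmem using fun s : (i : Fin m) → Fin i → Bool =>
    exists_pathSystem_of_tournament (orient_iff_not s)
  have hcard : Nat.card ((i : Fin m) → Fin i → Bool) = 2 ^ (m * (m - 1) / 2) := by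
    simp [Finset.prod_pow_eq_pow_sum, Fin.sum_univ_eq_sum_range (fun i => i), Finset.sum_range_id]
  rw [← hcard]
  refine Nat.card_le_card_of_injective (fun s => ⟨F s, hF s⟩) fun s t hst => ?_
  have hst : F s = F t := congrArg Subtype.val hst
  funext i j
  have hj : (⟨j, j.2.trans i.2⟩ : Fin m) < i := j.2
  have hs := hmem s i _ hj.ne'
  rw [hst, hmem t i _ hj.ne', orient_of_lt t hj, orient_of_lt s hj] at hs
  exact (Bool.eq_iff_iff.2 hs).symm
end

section
/- Let P be a consistent path system on [n] of diameter at most 2 and let f be its (unique) résumé. Then P is strictly metric if and only if there exists a symmetric vector x ∈ ℝ^{C(n,2)} (with entries x_{a,b} = x_{b,a} for distinct a,b ∈ [n]) such that x_{a,f(a,b)} + x_{f(a,b),b} < x_{a,c} + x_{c,b} for every pair {a,b} ∈ dom(f) and every c ∈ [n] \ {a, b, f(a,b)}. -/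
open SimpleGraph

/-- `f` is a résumé of the path system `P` on `[n]`: a partial function on unordered
pairs (encoded with `Option`), defined exactly on the pairs `{u,v}` whose path is not the
single edge `uv`, assigning to such a pair an internal vertex of `P_{u,v}`. -/
def IsResume {n : ℕ} (P : PathSystem (completeGraph (Fin n)))
    (f : Sym2 (Fin n) → Option (Fin n)) : Prop :=
  (∀ u : Fin n, f s(u, u) = none) ∧
  ∀ (u v : Fin n) (h : u ≠ v),
    (f s(u, v) = none ↔ (P.path u v h).val.length = 1) ∧
    ∀ c : Fin n, f s(u, v) = some c →
      c ∈ (P.path u v h).val.support ∧ c ≠ u ∧ c ≠ v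

/-- A walk of length one is the single edge between its endpoints. -/
theorem eq_toWalk_of_length_eq_one {V : Type*} {G : SimpleGraph V} {u v : V}
    {p : G.Walk u v} (hp : p.length = 1) (h : G.Adj u v) : p = h.toWalk := by
  match p, hp with
  | .cons _ .nil, _ => rfl

namespace PathSystem

section Wlen

variable {V : Type*} {G : SimpleGraph V}

theorem wlen_of_length_eq_one (w : Sym2 V → ℝ) {a b : V} {p : G.Walk a b}
    (hp : p.length = 1) : wlen w p = w s(a, b) := by
  rw [eq_toWalk_of_length_eq_one hp (SimpleGraph.Walk.adj_of_length_eq_one hp)]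
  simp [wlen]

theorem length_mul_le_wlen {w : Sym2 V → ℝ} {r : ℝ} (hw : ∀ e, r ≤ w e) {a b : V}
    (p : G.Walk a b) : p.length * r ≤ wlen w p := by
  have h := List.card_nsmul_le_sum (p.edges.map w) r (by simp; intros; apply hw)
  simpa [wlen] using h

end Wlen

section Resume

variable {n : ℕ} {P : PathSystem (completeGraph (Fin n))}
  {f : Sym2 (Fin n) → Option (Fin n)}

theorem length_eq_one_of_consistent (hP : P.Consistent)
    (hdiam : ∀ (u v : Fin n) (h : u ≠ v), (P.path u v h).val.length ≤ 2)
    {a b m : Fin n} (hab : a ≠ b) (ham : a ≠ m) (hmb : m ≠ b)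
    (hm : m ∈ (P.path a b hab).val.support) :
    (P.path a m ham).val.length = 1 ∧ (P.path m b hmb).val.length = 1 := by
  have hlen := congrArg SimpleGraph.Walk.length (hP a b hab m ham hmb hm)
  rw [SimpleGraph.Walk.length_append] at hlen
  have h2 := hdiam a b hab
  have h3 : (P.path a m ham).val.length ≠ 0 := fun h =>
    ham (SimpleGraph.Walk.eq_of_length_eq_zero h)
  have h4 : (P.path m b hmb).val.length ≠ 0 := fun h =>
    hmb (SimpleGraph.Walk.eq_of_length_eq_zero h)
  omega

/-- The chosen path of a pair in the domain of the résumé is the two-edge path through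
the résumé's value, and both of its edges lie outside the domain. -/
theorem path_of_resume_eq_some (hP : P.Consistent)
    (hdiam : ∀ (u v : Fin n) (h : u ≠ v), (P.path u v h).val.length ≤ 2)
    (hf : IsResume P f) {a b m : Fin n} (hab : a ≠ b) (hm : f s(a, b) = some m) :
    ∃ (ham : (completeGraph (Fin n)).Adj a m) (hmb : (completeGraph (Fin n)).Adj m b),
      (P.path a b hab).val = .cons ham (.cons hmb .nil) ∧
        f s(a, m) = none ∧ f s(m, b) = none := by
  obtain ⟨hsupp, hma, hmb⟩ := (hf.2 a b hab).2 m hm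
  obtain ⟨h1, h2⟩ := length_eq_one_of_consistent hP hdiam hab hma.symm hmb hsupp
  have ha : (completeGraph (Fin n)).Adj a m := SimpleGraph.Walk.adj_of_length_eq_one h1
  have hb : (completeGraph (Fin n)).Adj m b := SimpleGraph.Walk.adj_of_length_eq_one h2
  refine ⟨ha, hb, ?_, (hf.2 a m hma.symm).1.2 h1, (hf.2 m b hmb).1.2 h2⟩
  rw [hP a b hab m hma.symm hmb hsupp, eq_toWalk_of_length_eq_one h1 ha,
    eq_toWalk_of_length_eq_one h2 hb]
  rfl

theorem StrictlyMetric.exists_resume_lt (hP : P.Consistent)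
    (hdiam : ∀ (u v : Fin n) (h : u ≠ v), (P.path u v h).val.length ≤ 2)
    (hf : IsResume P f) (hS : P.StrictlyMetric) :
    ∃ x : Fin n → Fin n → ℝ, (∀ a b : Fin n, x a b = x b a) ∧
      ∀ (a b m : Fin n), f s(a, b) = some m →
        ∀ c : Fin n, c ≠ a → c ≠ b → c ≠ m → x a m + x m b < x a c + x c b := by
  obtain ⟨w, -, hw⟩ := hS
  refine ⟨fun a b => w s(a, b), fun a b => congrArg w Sym2.eq_swap, ?_⟩
  intro a b m hm c hca hcb hcm
  have hab : a ≠ b := by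
    rintro rfl
    simp [hf.1 a] at hm
  obtain ⟨ham, hmb, hpath, -, -⟩ := path_of_resume_eq_some hP hdiam hf hab hm
  have hac : (completeGraph (Fin n)).Adj a c := hca.symm
  have hcb' : (completeGraph (Fin n)).Adj c b := hcb
  have hlt := hw a b hab ⟨.cons hac (.cons hcb' .nil), by simp [hab, hca.symm, hcb]⟩ (by
    intro h
    have h' := congrArg (fun Q => Q.val.support) h
    simp [hpath, hcm] at h')
  simpa [hpath, wlen] using hlt

theorem strictlyMetric_of_resume_lt (hP : P.Consistent)
    (hdiam : ∀ (u v : Fin n) (h : u ≠ v), (P.path u v h).val.length ≤ 2)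
    (hf : IsResume P f) {x : Fin n → Fin n → ℝ} (hx : ∀ a b : Fin n, x a b = x b a)
    (hlt : ∀ (a b m : Fin n), f s(a, b) = some m →
      ∀ c : Fin n, c ≠ a → c ≠ b → c ≠ m → x a m + x m b < x a c + x c b) :
    P.StrictlyMetric := by
  obtain ⟨K, hK0, hK⟩ : ∃ K : ℝ, 0 ≤ K ∧ ∀ a b, |x a b| ≤ K := by
    refine ⟨∑ a, ∑ b, |x a b|, by positivity, fun a b => ?_⟩
    exact (Finset.single_le_sum (f := fun b => |x a b|) (fun _ _ => abs_nonneg _)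
      (Finset.mem_univ b)).trans (Finset.single_le_sum (f := fun a => ∑ b, |x a b|)
      (fun _ _ => Finset.sum_nonneg fun _ _ => abs_nonneg _) (Finset.mem_univ a))
  -- Shift `x` by a large constant and make the pairs in the domain of `f` very long.
  set M : ℝ := 6 * K + 1 with hM
  let y : Sym2 (Fin n) → ℝ := Sym2.lift ⟨x, hx⟩
  let w : Sym2 (Fin n) → ℝ := fun e => if f e = none then M + y e else 3 * M
  have hw_none : ∀ {a b : Fin n}, f s(a, b) = none → w s(a, b) = M + x a b :=
    fun h => if_pos h
  have hw_some : ∀ {a b : Fin n}, f s(a, b) ≠ none → w s(a, b) = 3 * M :=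
    fun h => if_neg h
  have hw_ge : ∀ e, M - K ≤ w e := by
    intro e
    induction e using Sym2.ind with
    | _ a b =>
      have := neg_le_of_abs_le (hK a b)
      by_cases h : f s(a, b) = none
      · rw [hw_none h]; linarith
      · rw [hw_some h]; linarith
  refine ⟨w, fun e _ => by linarith [hw_ge e], ?_⟩
  rintro a b hab ⟨Q, hQ⟩ hne
  replace hne : Q ≠ (P.path a b hab).val := fun h => hne (Subtype.ext h)
  have hQlen := length_mul_le_wlen hw_ge Q
  have hQ0 : Q.length ≠ 0 := fun h => hab (SimpleGraph.Walk.eq_of_length_eq_zero h)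
  rcases hfab : f s(a, b) with _ | m
  · have h1 := (hf.2 a b hab).1.1 hfab
    have hadj := SimpleGraph.Walk.adj_of_length_eq_one h1
    have hQ1 : Q.length ≠ 1 := fun h =>
      hne (by rw [eq_toWalk_of_length_eq_one h hadj, eq_toWalk_of_length_eq_one h1 hadj])
    have hQ2 : (2 : ℝ) ≤ Q.length := by exact_mod_cast (by omega : 2 ≤ Q.length)
    rw [wlen_of_length_eq_one w h1, hw_none hfab]
    have := le_of_abs_le (hK a b)
    nlinarith
  · obtain ⟨ham, hmb, hpath, hfam, hfmb⟩ := path_of_resume_eq_some hP hdiam hf hab hfab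
    have hPlen : wlen w (P.path a b hab).val = 2 * M + x a m + x m b := by
      rw [hpath]
      simp only [wlen, SimpleGraph.Walk.edges_cons, SimpleGraph.Walk.edges_nil, List.map_cons,
        List.map_nil, List.sum_cons, List.sum_nil, hw_none hfam, hw_none hfmb]
      ring
    have h1 := le_of_abs_le (hK a m)
    have h2 := le_of_abs_le (hK m b)
    change _ < wlen w Q
    rw [hPlen]
    match Q with
    | .nil => exact absurd rfl hab
    | .cons h .nil =>
      simp only [wlen, SimpleGraph.Walk.edges_cons, SimpleGraph.Walk.edges_nil, List.map_cons,
        List.map_nil, List.sum_cons, List.sum_nil, hw_some (by simp [hfab] : f s(a, b) ≠ none)]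
      linarith
    | .cons (v := c) hac (.cons hcb .nil) =>
      have hcm : c ≠ m := by
        rintro rfl
        exact hne hpath.symm
      have hx_lt := hlt a b m hfab c hac.ne.symm hcb.ne hcm
      have h3 := hw_ge s(a, c)
      have h4 := hw_ge s(c, b)
      simp only [wlen, SimpleGraph.Walk.edges_cons, SimpleGraph.Walk.edges_nil, List.map_cons,
        List.map_nil, List.sum_cons, List.sum_nil]
      by_cases hfac : f s(a, c) = none
      · by_cases hfcb : f s(c, b) = none
        · rw [hw_none hfac, hw_none hfcb]; linarith
        · rw [hw_some hfcb]; linarith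
      · rw [hw_some hfac]; linarith
    | .cons _ (.cons _ (.cons _ q)) =>
      simp only [SimpleGraph.Walk.length_cons] at hQlen
      push_cast at hQlen
      have : (0 : ℝ) ≤ q.length := by positivity
      nlinarith

end Resume

end PathSystem

theorem diam_two_strictly_metric_iff (n : ℕ)
    (P : PathSystem (completeGraph (Fin n))) (hP : P.Consistent)
    (hdiam : ∀ (u v : Fin n) (h : u ≠ v), (P.path u v h).val.length ≤ 2)
    (f : Sym2 (Fin n) → Option (Fin n)) (hf : IsResume P f) :
    P.StrictlyMetric ↔
      ∃ x : Fin n → Fin n → ℝ, (∀ a b : Fin n, x a b = x b a) ∧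
        ∀ (a b m : Fin n), f s(a, b) = some m →
          ∀ c : Fin n, c ≠ a → c ≠ b → c ≠ m →
            x a m + x m b < x a c + x c b := by
  constructor
  · exact PathSystem.StrictlyMetric.exists_resume_lt hP hdiam hf
  · rintro ⟨x, hx, hlt⟩
    exact PathSystem.strictlyMetric_of_resume_lt hP hdiam hf hx hlt
end

section
/- Define N(n) := Π_{i=1}^{n} Π_{j=1}^{n} (i+j+n−1)/(i+j−1) (MacMahon's count of (n,n,n)-boxed plane partitions) and S(n) := Π_{i=1}^{n} (2i+n−1)/(2i−1) · Π_{1≤i<j≤n} (i+j+n−1)/(i+j−1) (Andrews' count of symmetric (n,n) plane partitions). Then lim_{n→∞} (ln N(n))/n² = (9/2)ln 3 − 6 ln 2 and lim_{n→∞} (ln S(n))/n² = (9/4)ln 3 − 3 ln 2; that is, N(n) = (27/16)^{(3/2)n²(1+o(1))} and S(n) = (27/16)^{(3/4)n²(1+o(1))}. -/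
open SimpleGraph

/-- MacMahon's product `N(n,n,n)` counting `(n,n,n)`-boxed plane partitions. -/
noncomputable def Nmac (n : ℕ) : ℝ :=
  ∏ i ∈ Finset.Icc 1 n, ∏ j ∈ Finset.Icc 1 n,
    ((i : ℝ) + (j : ℝ) + (n : ℝ) - 1) / ((i : ℝ) + (j : ℝ) - 1)

/-- Andrews' product `S(n,n)` counting symmetric `(n,n)` plane partitions. -/
noncomputable def Sand (n : ℕ) : ℝ :=
  (∏ i ∈ Finset.Icc 1 n, (2 * (i : ℝ) + (n : ℝ) - 1) / (2 * (i : ℝ) - 1)) *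
    ∏ i ∈ Finset.Icc 1 n, ∏ j ∈ Finset.Icc (i + 1) n,
      ((i : ℝ) + (j : ℝ) + (n : ℝ) - 1) / ((i : ℝ) + (j : ℝ) - 1)

open Finset in
theorem prod_Icc_one_eq_prod_range (f : ℕ → ℝ) (n : ℕ) :
    ∏ i ∈ Icc 1 n, f i = ∏ i ∈ range n, f (i + 1) := by
  induction n with
  | zero => simp
  | succ n ih => rw [prod_Icc_succ_top (by omega), prod_range_succ, ih]

/-- A product of a symmetric function over a square is the diagonal part times the square of the
part strictly above the diagonal. -/
theorem prod_square_eq_diag_mul_sq (g : ℕ → ℕ → ℝ) (hg : ∀ i j, g i j = g j i) (n : ℕ) :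
    ∏ i ∈ Finset.Icc 1 n, ∏ j ∈ Finset.Icc 1 n, g i j =
      (∏ i ∈ Finset.Icc 1 n, g i i) *
        (∏ i ∈ Finset.Icc 1 n, ∏ j ∈ Finset.Icc (i + 1) n, g i j) ^ 2 := by
  induction n with
  | zero => simp
  | succ n ih =>
    have h1 : ∀ f : ℕ → ℝ, ∏ j ∈ Finset.Icc 1 (n + 1), f j =
        (∏ j ∈ Finset.Icc 1 n, f j) * f (n + 1) := fun f =>
      Finset.prod_Icc_succ_top (by omega) f
    have h2 : ∏ i ∈ Finset.Icc 1 n, ∏ j ∈ Finset.Icc (i + 1) (n + 1), g i j =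
        (∏ i ∈ Finset.Icc 1 n, ∏ j ∈ Finset.Icc (i + 1) n, g i j) *
          ∏ i ∈ Finset.Icc 1 n, g i (n + 1) := by
      rw [← Finset.prod_mul_distrib]
      refine Finset.prod_congr rfl fun i hi => ?_
      rw [Finset.mem_Icc] at hi
      exact Finset.prod_Icc_succ_top (by omega) _
    have h3 : ∏ j ∈ Finset.Icc 1 n, g (n + 1) j = ∏ i ∈ Finset.Icc 1 n, g i (n + 1) :=
      Finset.prod_congr rfl fun i _ => hg _ _
    simp only [h1]
    rw [h2, h3, Finset.prod_mul_distrib, ih, Finset.Icc_eq_empty (by omega : ¬ n + 1 + 1 ≤ n + 1),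
      Finset.prod_empty]
    ring

/-- The logarithm of the superfactorial `0! * 1! * ⋯ * (m - 1)!`. -/
noncomputable def logSuperfactorial (m : ℕ) : ℝ :=
  ∑ k ∈ Finset.range m, Real.log (k.factorial : ℝ)

/-- The leading part of `logSuperfactorial`. -/
noncomputable def logSuperfactorialMain (m : ℕ) : ℝ :=
  (m : ℝ) ^ 2 / 2 * Real.log m - 3 / 4 * (m : ℝ) ^ 2

theorem log_factorial_succ (m : ℕ) :
    Real.log ((m + 1).factorial : ℝ) = Real.log ((m : ℝ) + 1) + Real.log (m.factorial : ℝ) := by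
  rw [Nat.factorial_succ, Nat.cast_mul, Real.log_mul (by positivity) (by positivity)]
  push_cast
  rfl

theorem sum_log_add (a s : ℕ) :
    ∑ j ∈ Finset.range s, Real.log ((a : ℝ) + j + 1) =
      Real.log ((a + s).factorial : ℝ) - Real.log (a.factorial : ℝ) := by
  induction s with
  | zero => simp
  | succ s ih =>
    rw [Finset.sum_range_succ, ih, ← add_assoc a s 1, log_factorial_succ]
    push_cast
    ring

theorem sum_sum_log_add (c r s : ℕ) :
    ∑ i ∈ Finset.range r, ∑ j ∈ Finset.range s, Real.log ((i : ℝ) + j + c + 1) =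
      logSuperfactorial (r + s + c) - logSuperfactorial (r + c) - logSuperfactorial (s + c) +
        logSuperfactorial c := by
  induction r with
  | zero => simp
  | succ r ih =>
    have h := sum_log_add (r + c) s
    have e1 : ∀ j : ℕ, (r : ℝ) + j + c + 1 = ((r + c : ℕ) : ℝ) + j + 1 := fun j => by
      push_cast; ring
    rw [Finset.sum_range_succ, ih]
    simp only [e1]
    rw [h, show r + 1 + s + c = (r + s + c) + 1 by ring, show r + 1 + c = (r + c) + 1 by ring]
    unfold logSuperfactorial
    rw [Finset.sum_range_succ _ (r + s + c), Finset.sum_range_succ _ (r + c),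
      show r + c + s = r + s + c by ring]
    ring

theorem log_succ_sub_log_bounds (m : ℕ) :
    (m : ℝ) * (Real.log ((m : ℝ) + 1) - Real.log m) ≤ 1 ∧
      (m : ℝ) ≤ (m : ℝ) * (((m : ℝ) + 1) * (Real.log ((m : ℝ) + 1) - Real.log m)) := by
  rcases Nat.eq_zero_or_pos m with rfl | hm
  · simp
  have hm' : (0 : ℝ) < m := by exact_mod_cast hm
  rw [← Real.log_div (by positivity) (by positivity)]
  constructor
  · have h := Real.log_le_sub_one_of_pos (show 0 < ((m : ℝ) + 1) / m by positivity)
    calc (m : ℝ) * Real.log (((m : ℝ) + 1) / m) ≤ m * (((m : ℝ) + 1) / m - 1) := by gcongr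
      _ = 1 := by field_simp; ring
  · have h := Real.one_sub_inv_le_log_of_pos (show 0 < ((m : ℝ) + 1) / m by positivity)
    calc (m : ℝ) = m * (((m : ℝ) + 1) * (1 - (((m : ℝ) + 1) / m)⁻¹)) := by field_simp; ring
      _ ≤ _ := by gcongr

theorem log_factorial_bounds (m : ℕ) :
    (m : ℝ) * Real.log m - m ≤ Real.log (m.factorial : ℝ) ∧
      Real.log (m.factorial : ℝ) ≤ ((m : ℝ) + 1) * Real.log ((m : ℝ) + 1) - m := by
  induction m with
  | zero => simp
  | succ m ih =>
    have h1 := (log_succ_sub_log_bounds m).1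
    have h2 := (log_succ_sub_log_bounds (m + 1)).2
    rw [log_factorial_succ]
    push_cast at h2 ⊢
    have h3 := le_of_mul_le_mul_left (by linarith :
      ((m : ℝ) + 1) * 1 ≤ ((m : ℝ) + 1) * (((m : ℝ) + 1 + 1) *
        (Real.log ((m : ℝ) + 1 + 1) - Real.log ((m : ℝ) + 1)))) (by positivity)
    constructor
    · linarith [ih.1]
    · linarith [ih.2]

theorem abs_logSuperfactorial_step (m : ℕ) :
    |Real.log (m.factorial : ℝ) - (logSuperfactorialMain (m + 1) - logSuperfactorialMain m)| ≤
      Real.log ((m : ℝ) + 1) + 2 := by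
  obtain ⟨h1, h2⟩ := log_succ_sub_log_bounds m
  obtain ⟨h3, h4⟩ := log_factorial_bounds m
  have hm : (0 : ℝ) ≤ m := Nat.cast_nonneg m
  have hL : 0 ≤ Real.log ((m : ℝ) + 1) := Real.log_nonneg (by linarith)
  have h5 := mul_le_mul_of_nonneg_left h1 hm
  unfold logSuperfactorialMain
  push_cast
  rw [abs_le]
  constructor <;> nlinarith

theorem abs_logSuperfactorial_sub_main_le (m : ℕ) :
    |logSuperfactorial m - logSuperfactorialMain m| ≤ m * (Real.log m + 2) := by
  induction m with
  | zero => simp [logSuperfactorial, logSuperfactorialMain]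
  | succ m ih =>
    have h := abs_logSuperfactorial_step m
    have hs : logSuperfactorial (m + 1) = logSuperfactorial m + Real.log (m.factorial : ℝ) :=
      Finset.sum_range_succ _ _
    have hlog : (m : ℝ) * Real.log m ≤ m * Real.log ((m : ℝ) + 1) := by
      rcases Nat.eq_zero_or_pos m with rfl | hm
      · simp
      · gcongr
        linarith
    have h' := abs_add_le (logSuperfactorial m - logSuperfactorialMain m)
      (Real.log (m.factorial : ℝ) - (logSuperfactorialMain (m + 1) - logSuperfactorialMain m))
    rw [hs]
    push_cast
    calc _ = |logSuperfactorial m - logSuperfactorialMain m + (Real.log (m.factorial : ℝ) -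
            (logSuperfactorialMain (m + 1) - logSuperfactorialMain m))| := by congr 1; ring
      _ ≤ _ := by linarith

theorem tendsto_log_natCast_div_natCast :
    Filter.Tendsto (fun n : ℕ => Real.log n / (n : ℝ)) Filter.atTop (nhds 0) := by
  have h := Real.isLittleO_log_id_atTop.tendsto_div_nhds_zero
  exact h.comp tendsto_natCast_atTop_atTop

theorem tendsto_logSuperfactorial_error :
    Filter.Tendsto (fun m : ℕ => (logSuperfactorial m - logSuperfactorialMain m) / (m : ℝ) ^ 2)
      Filter.atTop (nhds 0) := by
  have h : Filter.Tendsto (fun n : ℕ => Real.log n / (n : ℝ) + 2 / (n : ℝ)) Filter.atTop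
      (nhds 0) := by
    simpa using tendsto_log_natCast_div_natCast.add (tendsto_const_div_atTop_nhds_zero_nat 2)
  refine squeeze_zero_norm' ?_ h
  filter_upwards [Filter.eventually_gt_atTop 0] with m hm
  have hm' : (0 : ℝ) < m := by exact_mod_cast hm
  rw [Real.norm_eq_abs, abs_div, abs_of_pos (by positivity : (0 : ℝ) < (m : ℝ) ^ 2),
    div_le_iff₀ (by positivity)]
  calc _ ≤ _ := abs_logSuperfactorial_sub_main_le m
    _ = _ := by field_simp

theorem log_Nmac (n : ℕ) :
    Real.log (Nmac n) = logSuperfactorial (3 * n) - 3 * logSuperfactorial (2 * n) +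
      3 * logSuperfactorial n := by
  have e : Nmac n = ∏ i ∈ Finset.range n, ∏ j ∈ Finset.range n,
      ((i : ℝ) + j + n + 1) / ((i : ℝ) + j + (0 : ℕ) + 1) := by
    unfold Nmac
    simp only [prod_Icc_one_eq_prod_range]
    refine Finset.prod_congr rfl fun i _ => Finset.prod_congr rfl fun j _ => ?_
    push_cast
    congr 1 <;> ring
  have hpos : ∀ i j c : ℕ, (i : ℝ) + j + c + 1 ≠ 0 := fun i j c => by positivity
  rw [e, Real.log_prod fun i _ => Finset.prod_ne_zero_iff.2 fun j _ =>
    div_ne_zero (hpos i j n) (hpos i j 0)]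
  have e2 : ∀ i : ℕ, Real.log (∏ j ∈ Finset.range n,
      ((i : ℝ) + j + n + 1) / ((i : ℝ) + j + (0 : ℕ) + 1)) =
      ∑ j ∈ Finset.range n, Real.log ((i : ℝ) + j + n + 1) -
        ∑ j ∈ Finset.range n, Real.log ((i : ℝ) + j + (0 : ℕ) + 1) := fun i => by
    rw [Real.log_prod fun j _ => div_ne_zero (hpos i j n) (hpos i j 0),
      ← Finset.sum_sub_distrib]
    exact Finset.sum_congr rfl fun j _ => Real.log_div (hpos i j n) (hpos i j 0)
  simp only [e2]
  rw [Finset.sum_sub_distrib, sum_sum_log_add, sum_sum_log_add,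
    show n + n + n = 3 * n by ring, show n + n + 0 = 2 * n by ring, show n + n = 2 * n by ring,
    add_zero, show logSuperfactorial 0 = 0 by simp [logSuperfactorial]]
  ring

theorem logSuperfactorialMain_combination {n : ℕ} (hn : 0 < n) :
    logSuperfactorialMain (3 * n) - 3 * logSuperfactorialMain (2 * n) +
      3 * logSuperfactorialMain n =
      ((9 / 2) * Real.log 3 - 6 * Real.log 2) * (n : ℝ) ^ 2 := by
  have hn' : (n : ℝ) ≠ 0 := by positivity
  unfold logSuperfactorialMain
  push_cast
  rw [Real.log_mul (by norm_num) hn', Real.log_mul (by norm_num) hn']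
  ring

theorem tendsto_log_Nmac :
    Filter.Tendsto (fun n : ℕ => Real.log (Nmac n) / (n : ℝ) ^ 2) Filter.atTop
      (nhds ((9 / 2) * Real.log 3 - 6 * Real.log 2)) := by
  have hE := tendsto_logSuperfactorial_error
  have h3 := hE.comp (Filter.tendsto_id.const_mul_atTop' (show 0 < 3 by norm_num))
  have h2 := hE.comp (Filter.tendsto_id.const_mul_atTop' (show 0 < 2 by norm_num))
  have h := (((h3.const_mul 9).sub (h2.const_mul 12)).add (hE.const_mul 3)).const_add
    ((9 / 2) * Real.log 3 - 6 * Real.log 2)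
  simp only [mul_zero, sub_zero, add_zero] at h
  refine h.congr' ?_
  filter_upwards [Filter.eventually_gt_atTop 0] with n hn
  have hn' : (n : ℝ) ≠ 0 := by positivity
  have hc := logSuperfactorialMain_combination hn
  rw [log_Nmac, eq_div_iff (by positivity), add_mul, ← hc]
  simp only [Function.comp_apply, id_eq]
  push_cast
  field_simp
  ring

/-- The diagonal factor of `Sand`. -/
noncomputable def diagProd (n : ℕ) : ℝ :=
  ∏ i ∈ Finset.Icc 1 n, (2 * (i : ℝ) + (n : ℝ) - 1) / (2 * (i : ℝ) - 1)

theorem diagProd_factor_bounds (n : ℕ) {i : ℕ} (hi : 1 ≤ i) :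
    1 ≤ (2 * (i : ℝ) + (n : ℝ) - 1) / (2 * (i : ℝ) - 1) ∧
      (2 * (i : ℝ) + (n : ℝ) - 1) / (2 * (i : ℝ) - 1) ≤ n + 1 := by
  have hi' : (1 : ℝ) ≤ i := by exact_mod_cast hi
  have hn : (0 : ℝ) ≤ n := Nat.cast_nonneg n
  have hd : 0 < 2 * (i : ℝ) - 1 := by linarith
  rw [le_div_iff₀ hd, div_le_iff₀ hd]
  constructor <;> nlinarith

theorem one_le_diagProd (n : ℕ) : 1 ≤ diagProd n :=
  Finset.one_le_prod fun _ hi => (diagProd_factor_bounds n (Finset.mem_Icc.1 hi).1).1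

theorem diagProd_le (n : ℕ) : diagProd n ≤ ((n : ℝ) + 1) ^ n := by
  have h := Finset.prod_le_prod (s := Finset.Icc 1 n)
    (fun i hi => zero_le_one.trans (diagProd_factor_bounds n (Finset.mem_Icc.1 hi).1).1)
    (fun i hi => (diagProd_factor_bounds n (Finset.mem_Icc.1 hi).1).2)
  simpa [diagProd] using h

theorem Nmac_eq_diagProd_mul_sq (n : ℕ) :
    Nmac n = diagProd n * (∏ i ∈ Finset.Icc 1 n, ∏ j ∈ Finset.Icc (i + 1) n,
      ((i : ℝ) + (j : ℝ) + (n : ℝ) - 1) / ((i : ℝ) + (j : ℝ) - 1)) ^ 2 := by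
  unfold Nmac diagProd
  rw [prod_square_eq_diag_mul_sq (fun i j =>
    ((i : ℝ) + (j : ℝ) + (n : ℝ) - 1) / ((i : ℝ) + (j : ℝ) - 1))
    (fun i j => by rw [add_comm (i : ℝ) j])]
  simp only [two_mul]

theorem log_Sand (n : ℕ) :
    Real.log (Sand n) = (Real.log (Nmac n) + Real.log (diagProd n)) / 2 := by
  have hS : Sand n ^ 2 = Nmac n * diagProd n := by
    rw [Nmac_eq_diagProd_mul_sq]
    unfold Sand diagProd
    ring
  have hD : diagProd n ≠ 0 := (zero_lt_one.trans_le (one_le_diagProd n)).ne'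
  have hN : Nmac n ≠ 0 := by
    unfold Nmac
    refine Finset.prod_ne_zero_iff.2 fun i hi => Finset.prod_ne_zero_iff.2 fun j hj => ?_
    have hi' : (1 : ℝ) ≤ i := by exact_mod_cast (Finset.mem_Icc.1 hi).1
    have hj' : (1 : ℝ) ≤ j := by exact_mod_cast (Finset.mem_Icc.1 hj).1
    have hn : (0 : ℝ) ≤ n := Nat.cast_nonneg n
    exact div_ne_zero (by linarith) (by linarith)
  have h := congrArg Real.log hS
  rw [Real.log_pow, Real.log_mul hN hD] at h
  push_cast at h
  linarith

theorem tendsto_log_diagProd :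
    Filter.Tendsto (fun n : ℕ => Real.log (diagProd n) / (n : ℝ) ^ 2) Filter.atTop (nhds 0) := by
  have h : Filter.Tendsto (fun n : ℕ => Real.log n / (n : ℝ) + Real.log 2 / (n : ℝ)) Filter.atTop
      (nhds 0) := by
    simpa using tendsto_log_natCast_div_natCast.add
      (tendsto_const_div_atTop_nhds_zero_nat (Real.log 2))
  refine squeeze_zero' (Filter.Eventually.of_forall fun n =>
    div_nonneg (Real.log_nonneg (one_le_diagProd n)) (by positivity)) ?_ h
  filter_upwards [Filter.eventually_gt_atTop 0] with n hn
  have hn' : (1 : ℝ) ≤ n := by exact_mod_cast hn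
  have hD : 0 < diagProd n := zero_lt_one.trans_le (one_le_diagProd n)
  rw [div_le_iff₀ (by positivity)]
  calc Real.log (diagProd n) ≤ Real.log (((n : ℝ) + 1) ^ n) := Real.log_le_log hD (diagProd_le n)
    _ = n * Real.log ((n : ℝ) + 1) := Real.log_pow _ _
    _ ≤ n * Real.log (n * 2) := by gcongr; linarith
    _ = _ := by
      rw [Real.log_mul (by positivity) (by norm_num)]
      field_simp

theorem macmahon_asymptotics :
    Filter.Tendsto (fun n : ℕ => Real.log (Nmac n) / (n : ℝ) ^ 2) Filter.atTop
      (nhds ((9 / 2) * Real.log 3 - 6 * Real.log 2)) ∧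
    Filter.Tendsto (fun n : ℕ => Real.log (Sand n) / (n : ℝ) ^ 2) Filter.atTop
      (nhds ((9 / 4) * Real.log 3 - 3 * Real.log 2)) := by
  refine ⟨tendsto_log_Nmac, ?_⟩
  have h := (tendsto_log_Nmac.add tendsto_log_diagProd).div_const 2
  convert h using 2 with n
  · rw [log_Sand]
    ring
  · ring
end

section
/- Let M(n) denote the number of monotone path systems in J_n, i.e. the number of symmetric functions k : {(i,j) : i ≠ j, i,j ∈ [n]} → [n] with k(i,j) = k(j,i) such that for every fixed i the map j ↦ k(i,j) is non-decreasing in j. Then lim_{n→∞} (ln M(n))/n² = (3/4)(3 ln 3 − 4 ln 2). -/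
open SimpleGraph

/-- A monotone path system in `J_n`, encoded as a symmetric function
`k(i,j)` defined for `i ≠ j` which is non-decreasing in `j` for every fixed `i`. -/
def MonoSystem (n : ℕ) : Type :=
  {k : ∀ i j : Fin n, i ≠ j → Fin n //
    (∀ (i j : Fin n) (h : i ≠ j), k i j h = k j i (Ne.symm h)) ∧
    (∀ (i j j' : Fin n) (h : i ≠ j) (h' : i ≠ j'), j ≤ j' → k i j h ≤ k i j' h')}

section

open Finset Nat

theorem det_choose_succ {N : ℕ} (v : Fin (N + 1) → ℕ) :
    (Matrix.of fun i j : Fin (N + 1) => ((v i).choose j : ℤ)).det =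
      (Matrix.of fun i j : Fin N =>
        ((v i.succ).choose (j + 1) : ℤ) - ((v i.castSucc).choose (j + 1) : ℤ)).det := by
  let B : Matrix (Fin (N + 1)) (Fin (N + 1)) ℤ := Matrix.of fun i j =>
    Fin.cases ((v 0).choose j : ℤ)
      (fun i' => ((v i'.succ).choose j : ℤ) - ((v i'.castSucc).choose j : ℤ)) i
  have h : (Matrix.of fun i j : Fin (N + 1) => ((v i).choose j : ℤ)).det = B.det :=
    Matrix.det_eq_of_forall_row_eq_smul_add_pred (fun _ => 1) (fun j => by simp [B])
      (fun i j => by simp [B])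
  rw [h, Matrix.det_succ_column_zero, Fin.sum_univ_succ]
  simp only [B, Matrix.of_apply, Fin.cases_zero, Fin.cases_succ, Fin.val_zero, Nat.choose_zero_right]
  simp
  rfl

theorem sum_Icc_choose (a b i j : ℕ) (h : a ≤ b) :
    ∑ m ∈ Icc a b, ((m + i).choose j : ℤ) =
      ((b + (i + 1)).choose (j + 1) : ℤ) - ((a + i).choose (j + 1) : ℤ) := by
  induction b, h using Nat.le_induction with
  | base =>
    have := Nat.choose_succ_succ (a + i) j
    simp only [Icc_self, sum_singleton, ← add_assoc]
    push_cast [this]; ring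
  | succ b h ih =>
    have := Nat.choose_succ_succ (b + 1 + i) j
    rw [Finset.sum_Icc_succ_top (by omega), ih, ← add_assoc (b + 1) i 1]
    push_cast [this]
    rw [show b + 1 + i = b + (i + 1) by omega]; ring

theorem sum_det_choose {N : ℕ} (l : Fin (N + 1) → ℕ) (hl : Monotone l) :
    ∑ m ∈ Fintype.piFinset fun i : Fin N => Icc (l i.castSucc) (l i.succ),
        (Matrix.of fun i j : Fin N => ((m i + i).choose j : ℤ)).det =
      (Matrix.of fun i j : Fin (N + 1) => ((l i + i).choose j : ℤ)).det := by
  rw [det_choose_succ]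
  have := (Matrix.detRowAlternating (n := Fin N) (R := ℤ)).toMultilinearMap.map_sum_finset
    (fun (i : Fin N) (m : ℕ) (j : Fin N) => ((m + i).choose j : ℤ))
    (fun i : Fin N => Icc (l i.castSucc) (l i.succ))
  refine this.symm.trans ?_
  change Matrix.det _ = _
  congr 1
  ext i j
  simp only [Finset.sum_apply, Matrix.of_apply]
  rw [sum_Icc_choose _ _ _ _ (hl i.castSucc_lt_succ.le)]
  simp

theorem prod_factorial_mul_det_choose {N : ℕ} (v : Fin N → ℕ) :
    (∏ i ∈ range N, (i ! : ℤ)) * (Matrix.of fun i j : Fin N => ((v i).choose j : ℤ)).det =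
      (Matrix.vandermonde fun i => (v i : ℤ)).det := by
  rw [Matrix.det_eval_matrixOfPolynomials_eq_det_vandermonde (fun i => (v i : ℤ))
    (fun i => descPochhammer ℤ i) (fun i => descPochhammer_natDegree ℤ i)
    (fun i => monic_descPochhammer ℤ i), ← Fin.prod_univ_eq_prod_range (fun i => (i ! : ℤ)),
    ← Matrix.det_mul_row]
  congr 1
  ext i j
  simp only [Matrix.of_apply, descPochhammer_eval_eq_descFactorial,
    Nat.descFactorial_eq_factorial_mul_choose]
  push_cast; rfl

theorem det_vandermonde_eq_prod_range {R : Type*} [CommRing R] (N : ℕ) (v : ℕ → R) :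
    (Matrix.vandermonde fun i : Fin N => v i).det =
      ∏ j ∈ range N, ∏ i ∈ range j, (v j - v i) := by
  rw [Matrix.det_vandermonde, Finset.prod_comm' (t' := univ) (s' := fun j => Iio j) (by simp),
    ← Fin.prod_univ_eq_prod_range (fun j => ∏ i ∈ range j, (v j - v i))]
  refine prod_congr rfl fun j _ => ?_
  have := Fin.map_valEmbedding_Iio j
  rw [Nat.Iio_eq_range] at this
  rw [← this, Finset.prod_map]
  rfl

/-- The arrays `a i j`, `i ≤ j < N`, of natural numbers which weakly increase in both indices and
have diagonal `l`, extended by zero. -/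
def halfArrays (N : ℕ) (l : Fin N → ℕ) : Set (ℕ → ℕ → ℕ) :=
  {a | (∀ i j, ¬(i ≤ j ∧ j < N) → a i j = 0) ∧ (∀ i : Fin N, a i i = l i) ∧
    ∀ i j, i ≤ j → j + 1 < N → a i j ≤ a i (j + 1) ∧ a i (j + 1) ≤ a (i + 1) (j + 1)}

/-- Removing the diagonal of a half array leaves a smaller half array, whose diagonal interlaces
the removed one. -/
def halfArraysSuccEquiv (N : ℕ) (l : Fin (N + 1) → ℕ) :
    halfArrays (N + 1) l ≃
      Σ m : (Fintype.piFinset fun i : Fin N => Icc (l i.castSucc) (l i.succ)),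
        halfArrays N m.1 where
  toFun a := ⟨⟨fun i => a.1 i (i + 1), by
      obtain ⟨a, h0, hd, hm⟩ := a
      simp only [Fintype.mem_piFinset, mem_Icc]
      intro i
      have := hm i i le_rfl (by omega)
      have h1 := hd i.castSucc
      have h2 := hd i.succ
      simp only [Fin.val_castSucc, Fin.val_succ] at h1 h2
      omega⟩, ⟨fun i j => if i ≤ j then a.1 i (j + 1) else 0, by
      obtain ⟨a, h0, hd, hm⟩ := a
      refine ⟨fun i j hij => ?_, fun i => by simp, fun i j hij hj => ?_⟩
      · dsimp only
        split_ifs with h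
        · exact h0 _ _ (by omega)
        · rfl
      · have := hm i (j + 1) (by omega) (by omega)
        simp only [hij, show i ≤ j + 1 by omega, show i + 1 ≤ j + 1 by omega, if_true]
        exact this⟩⟩
  invFun p := ⟨fun i j => if h : i = j ∧ j < N + 1 then l ⟨j, h.2⟩ else
      if i < j then p.2.1 i (j - 1) else 0, by
    obtain ⟨⟨m, hm⟩, ⟨a, h0, hd, ha⟩⟩ := p
    simp only [Fintype.mem_piFinset, mem_Icc] at hm
    refine ⟨fun i j hij => ?_, fun i => ?_, fun i j hij hj => ?_⟩
    · dsimp only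
      rw [dif_neg (by omega)]
      split_ifs with h
      · exact h0 _ _ (by omega)
      · rfl
    · dsimp only
      rw [dif_pos ⟨rfl, i.2⟩]
    · dsimp only
      rw [dif_neg (show ¬(i = j + 1 ∧ j + 1 < N + 1) by omega), if_pos (show i < j + 1 by omega),
        Nat.add_sub_cancel]
      rcases hij.eq_or_lt with rfl | hlt
      · rw [dif_pos ⟨rfl, by omega⟩, dif_pos ⟨rfl, by omega⟩]
        have h1 := hm ⟨i, by omega⟩
        have h2 := hd ⟨i, by omega⟩
        dsimp only at h2
        rw [h2]
        exact h1
      · rw [dif_neg (by omega), dif_neg (by omega), if_pos hlt, if_pos (by omega)]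
        have := ha i (j - 1) (by omega) (by omega)
        rwa [show j - 1 + 1 = j by omega] at this⟩
  left_inv := by
    rintro ⟨a, h0, hd, hm⟩
    ext i j
    dsimp only
    split_ifs with h1 h2 h3
    · obtain ⟨rfl, h⟩ := h1
      exact (hd ⟨i, h⟩).symm
    · rw [show j - 1 + 1 = j by omega]
    · omega
    · exact (h0 _ _ (by omega)).symm
  right_inv := by
    rintro ⟨⟨m, hm⟩, ⟨a, h0, hd, ha⟩⟩
    have hm' : (fun i : Fin N => a i i) = m := funext hd
    subst hm'
    have key : ∀ i j, (if i ≤ j then (if h : i = j + 1 ∧ j + 1 < N + 1 then l ⟨j + 1, h.2⟩ else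
        if i < j + 1 then a i (j + 1 - 1) else 0) else 0) = a i j := by
      intro i j
      split_ifs with h1 h2 h3
      · omega
      · simp
      · omega
      · exact (h0 _ _ (by omega)).symm
    refine Sigma.subtype_ext (Subtype.ext (funext fun i => ?_)) (funext₂ key)
    have := key i i
    rw [if_pos le_rfl] at this
    exact this

theorem card_halfArrays {N : ℕ} (l : Fin N → ℕ) (hl : Monotone l) :
    Finite (halfArrays N l) ∧ (Nat.card (halfArrays N l) : ℤ) =
      (Matrix.of fun i j : Fin N => ((l i + i).choose j : ℤ)).det := by
  induction N with
  | zero =>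
    have : halfArrays 0 l = {fun _ _ => 0} := by
      ext a
      simp only [halfArrays, Set.mem_ofPred_eq, Set.mem_singleton_iff]
      constructor
      · rintro ⟨h, -⟩
        ext i j
        exact h i j (by omega)
      · rintro rfl
        simp
    rw [this]
    exact ⟨inferInstance, by simp⟩
  | succ N ih =>
    have hmono : ∀ m ∈ Fintype.piFinset fun i : Fin N => Icc (l i.castSucc) (l i.succ),
        Monotone m := by
      intro m hm i j hij
      simp only [Fintype.mem_piFinset, mem_Icc] at hm
      rcases hij.eq_or_lt with rfl | hlt
      · rfl
      · exact (hm i).2.trans ((hl (by exact hlt)).trans (hm j).1)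
    have hfin : ∀ m : (Fintype.piFinset fun i : Fin N => Icc (l i.castSucc) (l i.succ)),
        Finite (halfArrays N m.1) := fun m => (ih m.1 (hmono _ m.2)).1
    refine ⟨Finite.of_equiv _ (halfArraysSuccEquiv N l).symm, ?_⟩
    rw [Nat.card_congr (halfArraysSuccEquiv N l), Nat.card_sigma, ← sum_det_choose l hl]
    push_cast
    refine Eq.trans (Finset.sum_congr rfl fun m _ => (ih m.1 (hmono _ m.2)).2)
      (Finset.sum_coe_sort _ fun m : Fin N → ℕ =>
        (Matrix.of fun i j : Fin N => ((m i + i).choose j : ℤ)).det)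

theorem halfArrays_row_le {N : ℕ} {l : Fin N → ℕ} {a : ℕ → ℕ → ℕ} (ha : a ∈ halfArrays N l)
    {i j j' : ℕ} (hij : i ≤ j) (hjj' : j ≤ j') (hj' : j' < N) : a i j ≤ a i j' := by
  induction j', hjj' using Nat.le_induction with
  | base => rfl
  | succ k hk ih => exact (ih (by omega)).trans (ha.2.2 i k (by omega) hj').1

theorem halfArrays_col_le {N : ℕ} {l : Fin N → ℕ} {a : ℕ → ℕ → ℕ} (ha : a ∈ halfArrays N l)
    {i i' j : ℕ} (hii' : i ≤ i') (hij : i' ≤ j) (hj : j < N) : a i j ≤ a i' j := by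
  induction i', hii' using Nat.le_induction with
  | base => rfl
  | succ k hk ih =>
    obtain ⟨j, rfl⟩ : ∃ j', j = j' + 1 := ⟨j - 1, by omega⟩
    exact (ih (by omega)).trans (ha.2.2 k j (by omega) hj).2

/-- The plane partitions in an `n × n × c` box. -/
def boxArrays (n c : ℕ) : Set (Fin n → Fin n → Fin (c + 1)) :=
  {p | (∀ i, Monotone (p i)) ∧ ∀ j, Monotone fun i => p i j}

/-- Plane partitions in a box are the half arrays with diagonal `0, …, 0, c, …, c`: such a half
array is constant outside a square. -/
def boxArraysEquiv (n c : ℕ) :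
    boxArrays n c ≃ halfArrays (n + n) fun i => if (i : ℕ) < n then 0 else c where
  toFun p := ⟨fun i j => if h : i < n ∧ n ≤ j ∧ j < n + n then
        p.1 ⟨i, h.1⟩ ⟨j - n, by omega⟩ else if n ≤ i ∧ i ≤ j ∧ j < n + n then c else 0, by
      obtain ⟨p, hr, hc⟩ := p
      refine ⟨fun i j hij => ?_, fun i => ?_, fun i j hij hj => ?_⟩
      · dsimp only
        rw [dif_neg (by omega), if_neg (by omega)]
      · dsimp only
        rw [dif_neg (by omega)]
        split_ifs <;> omega
      · dsimp only
        constructor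
        · split_ifs with h1 h2 h3 h4 h5 h6
          · exact hr _ (Fin.mk_le_mk.2 (by omega))
          all_goals omega
        · split_ifs with h1 h2 h3 h4 h5 h6
          · exact hc _ (Fin.mk_le_mk.2 (by omega))
          all_goals omega⟩
  invFun a := ⟨fun i j => ⟨a.1 i (n + j), by
      have h1 := halfArrays_col_le a.2 (i := i) (i' := n + j) (j := n + j) (by omega) le_rfl
        (by omega)
      have h2 := a.2.2.1 ⟨n + j, by omega⟩
      dsimp only at h2
      rw [if_neg (by omega)] at h2
      omega⟩, by
      refine ⟨fun i j j' h => ?_, fun j i i' h => ?_⟩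
      · exact halfArrays_row_le a.2 (by omega) (Nat.add_le_add_left h n) (by omega)
      · exact halfArrays_col_le a.2 h (by omega) (by omega)⟩
  left_inv := by
    rintro ⟨p, hr, hc⟩
    ext i j
    simp
  right_inv := by
    rintro ⟨a, ha⟩
    ext i j
    dsimp only
    split_ifs with h1 h2
    · rw [Nat.add_sub_cancel' h1.2.1]
    · have h3 := halfArrays_row_le ha (i := i) (j := i) (j' := j) le_rfl (by omega) (by omega)
      have h4 := halfArrays_col_le ha (i := i) (i' := j) (j := j) (by omega) le_rfl (by omega)
      have h5 := ha.2.1 ⟨i, by omega⟩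
      have h6 := ha.2.1 ⟨j, by omega⟩
      dsimp only at h5 h6
      rw [if_neg (by omega)] at h5 h6
      omega
    · by_cases h : i ≤ j ∧ j < n + n
      · have h4 := halfArrays_col_le ha (i := i) (i' := j) (j := j) (by omega) le_rfl (by omega)
        have h6 := ha.2.1 ⟨j, by omega⟩
        dsimp only at h6
        rw [if_pos (by omega)] at h6
        omega
      · exact (ha.1 _ _ h).symm

theorem prod_factorial_mul_card_boxArrays (n c : ℕ) :
    (∏ i ∈ range (n + n), i !) * Nat.card (boxArrays n c) * ∏ i ∈ range n, (c + i)! =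
      (∏ i ∈ range n, i !) * (∏ i ∈ range n, i !) * ∏ i ∈ range n, (n + c + i)! := by
  have hl : Monotone fun i : Fin (n + n) => if (i : ℕ) < n then 0 else c := by
    intro i j hij
    dsimp only
    have : (i : ℕ) ≤ j := hij
    split_ifs <;> omega
  set v : ℕ → ℕ := fun i => (if i < n then 0 else c) + i with hv
  have h1 := (card_halfArrays _ hl).2
  rw [← Nat.card_congr (boxArraysEquiv n c)] at h1
  have h2 := prod_factorial_mul_det_choose (N := n + n) fun i => v i
  rw [← h1, det_vandermonde_eq_prod_range _ fun i => (v i : ℤ)] at h2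
  have h3 : ∀ j, ∏ i ∈ range j, ((j : ℤ) - i) = (j ! : ℤ) := by
    intro j
    rw [← Finset.prod_range_reflect, ← Finset.prod_range_add_one_eq_factorial]
    push_cast
    refine prod_congr rfl fun i hi => ?_
    have := mem_range.1 hi
    push_cast [show i ≤ j - 1 by omega, show 1 ≤ j by omega]
    ring
  have h4 : ∏ j ∈ range n, ∏ i ∈ range j, ((v j : ℤ) - v i) = ∏ j ∈ range n, (j ! : ℤ) := by
    refine prod_congr rfl fun j hj => ?_
    rw [← h3]
    refine prod_congr rfl fun i hi => ?_
    have hj := mem_range.1 hj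
    have hi := mem_range.1 hi
    simp [hv, hj, hi.trans hj]
  have h5 : ∀ b, (∏ i ∈ range n, (((n + c + b : ℕ) : ℤ) - i)) * ((c + b)! : ℤ) =
      ((n + c + b)! : ℤ) := by
    intro b
    have : ∀ k, (∏ i ∈ range k, (((k + (c + b) : ℕ) : ℤ) - i)) * ((c + b)! : ℤ) =
        ((k + (c + b))! : ℤ) := by
      intro k
      induction k with
      | zero => simp
      | succ k ih =>
        rw [prod_range_succ', show k + 1 + (c + b) = k + (c + b) + 1 by ring,
          Nat.factorial_succ, Nat.cast_mul, ← ih]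
        push_cast
        simp only [sub_zero, add_sub_add_right_eq_sub]
        ring
    rw [add_assoc]
    exact this n
  have h6 : (∏ b ∈ range n, ∏ i ∈ range (n + b), ((v (n + b) : ℤ) - v i)) *
      ∏ b ∈ range n, ((c + b)! : ℤ) =
      (∏ b ∈ range n, (b ! : ℤ)) * ∏ b ∈ range n, ((n + c + b)! : ℤ) := by
    rw [← prod_mul_distrib, ← prod_mul_distrib]
    refine prod_congr rfl fun b _ => ?_
    rw [← h5, ← h3 b, prod_range_add]
    have e1 : ∏ i ∈ range n, ((v (n + b) : ℤ) - v i) =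
        ∏ i ∈ range n, (((n + c + b : ℕ) : ℤ) - i) := by
      refine prod_congr rfl fun i hi => ?_
      simp [hv, mem_range.1 hi]
      ring
    have e2 : ∏ i ∈ range b, ((v (n + b) : ℤ) - v (n + i)) = ∏ i ∈ range b, ((b : ℤ) - i) := by
      refine prod_congr rfl fun i hi => ?_
      simp [hv]
    rw [e1, e2]
    ring
  have h7 : (∏ i ∈ range (n + n), (i ! : ℤ)) * Nat.card (boxArrays n c) *
      ∏ i ∈ range n, ((c + i)! : ℤ) =
      (∏ i ∈ range n, (i ! : ℤ)) * (∏ i ∈ range n, (i ! : ℤ)) *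
        ∏ i ∈ range n, ((n + c + i)! : ℤ) := by
    rw [h2, prod_range_add, h4, mul_assoc, h6]
    ring
  exact_mod_cast h7

instance (n : ℕ) : Finite (MonoSystem n) := by
  unfold MonoSystem
  infer_instance

/-- A choice of diagonal entries which extends a monotone system to a symmetric matrix with
monotone rows. -/
def MonoSystem.diag {c : ℕ} (k : MonoSystem (c + 1)) (i : Fin (c + 1)) : Fin (c + 1) :=
  if h : (i : ℕ) = 0 then 0 else
    k.1 i ⟨i - 1, by omega⟩ (fun e => h (by have := Fin.ext_iff.1 e; dsimp only at this; omega))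

theorem MonoSystem.le_diag {c : ℕ} (k : MonoSystem (c + 1)) {i j : Fin (c + 1)} (h : j < i) :
    k.1 i j h.ne' ≤ k.diag i := by
  have h' : (j : ℕ) < i := h
  rw [MonoSystem.diag, dif_neg (by omega)]
  exact k.2.2 _ _ _ _ _ (Fin.mk_le_mk.2 (by omega))

theorem MonoSystem.diag_le {c : ℕ} (k : MonoSystem (c + 1)) {i j : Fin (c + 1)} (h : i < j) :
    k.diag i ≤ k.1 i j h.ne := by
  have h' : (i : ℕ) < j := h
  unfold MonoSystem.diag
  split_ifs with h0
  · exact Fin.zero_le _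
  · exact k.2.2 _ _ _ _ _ (Fin.mk_le_mk.2 (by omega))

/-- The matrix with entries of `k` above the diagonal and entries of `k'` below it. -/
def MonoSystem.glue {c : ℕ} (k k' : MonoSystem (c + 1)) (i j : Fin (c + 1)) : Fin (c + 1) :=
  if h : i < j then k.1 i j h.ne else if h : j < i then k'.1 i j h.ne' else k.diag i

theorem MonoSystem.glue_mem {c : ℕ} {k k' : MonoSystem (c + 1)} (hd : k.diag = k'.diag) :
    k.glue k' ∈ boxArrays (c + 1) c := by
  refine ⟨fun i j j' hj => ?_, fun j i i' hi => ?_⟩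
  · unfold MonoSystem.glue
    split_ifs with h1 h2 h3 h4 h5 h6 h7
    · exact k.2.2 _ _ _ _ _ hj
    · exact absurd (h1.trans_le hj) h2
    · exact absurd (h1.trans_le hj) h2
    · exact (k'.le_diag h4).trans (hd ▸ k.diag_le h5)
    · exact k'.2.2 _ _ _ _ _ hj
    · exact (k'.le_diag h4).trans_eq (by rw [hd])
    · exact k.diag_le h7
    all_goals first | exact le_rfl | (exfalso; order)
  · dsimp only
    unfold MonoSystem.glue
    split_ifs with h1 h2 h3 h4 h5 h6 h7
    · rw [k.2.1, k.2.1 i']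
      exact k.2.2 _ _ _ _ _ hi
    · rw [k.2.1]
      exact ((k.le_diag h1).trans_eq (by rw [hd])).trans ((k'.diag_le h3).trans_eq (k'.2.1 _ _ _))
    · obtain rfl : i' = j := by order
      rw [k.2.1]
      exact k.le_diag h1
    · exfalso; order
    · rw [k'.2.1, k'.2.1 i']
      exact k'.2.2 _ _ _ _ _ hi
    · exfalso; order
    · exfalso; order
    · obtain rfl : i = j := by order
      rw [hd, k'.2.1]
      exact k'.diag_le ‹_›
    · obtain rfl : i = i' := by order
      exact le_rfl

theorem MonoSystem.ext_of_lt {n : ℕ} {k l : MonoSystem n}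
    (h : ∀ i j (hij : i < j), k.1 i j hij.ne = l.1 i j hij.ne) : k = l := by
  refine Subtype.ext (funext fun i => funext fun j => funext fun hij => ?_)
  rcases lt_or_gt_of_ne hij with hlt | hlt
  · exact h i j hlt
  · rw [k.2.1, l.2.1]
    exact h j i hlt

theorem MonoSystem.glue_injective {c : ℕ} {k k' l l' : MonoSystem (c + 1)}
    (h : k.glue k' = l.glue l') : k = l ∧ k' = l' := by
  constructor
  · refine MonoSystem.ext_of_lt fun i j hij => ?_
    have := congrFun₂ h i j
    simpa [MonoSystem.glue, hij] using this
  · refine MonoSystem.ext_of_lt fun i j hij => ?_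
    have := congrFun₂ h j i
    rw [k'.2.1, l'.2.1]
    simpa [MonoSystem.glue, hij, hij.not_gt] using this

/-- The entries of a plane partition above the diagonal. -/
def upperSystem {c : ℕ} (p : boxArrays (c + 1) c) : MonoSystem (c + 1) :=
  ⟨fun i j _ => p.1 (min i j) (max i j), fun i j _ => by dsimp only; rw [min_comm, max_comm],
    fun i _ _ _ _ h => (p.2.1 _ (max_le_max_left i h)).trans (p.2.2 _ (min_le_min_left i h))⟩

/-- The entries of a plane partition below the diagonal. -/
def lowerSystem {c : ℕ} (p : boxArrays (c + 1) c) : MonoSystem (c + 1) :=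
  ⟨fun i j _ => p.1 (max i j) (min i j), fun i j _ => by dsimp only; rw [min_comm, max_comm],
    fun i _ _ _ _ h => (p.2.1 _ (min_le_min_left i h)).trans (p.2.2 _ (max_le_max_left i h))⟩

theorem card_boxArrays_le (c : ℕ) :
    Nat.card (boxArrays (c + 1) c) ≤ Nat.card (MonoSystem (c + 1)) ^ 2 * (c + 1) ^ (c + 1) := by
  have hinj : Function.Injective fun p : boxArrays (c + 1) c =>
      (upperSystem p, lowerSystem p, fun i => p.1 i i) := by
    intro p q h
    simp only [Prod.mk.injEq] at h
    obtain ⟨h1, h2, h3⟩ := h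
    refine Subtype.ext (funext₂ fun i j => ?_)
    rcases lt_trichotomy i j with hij | rfl | hij
    · have := congrArg (fun k : MonoSystem (c + 1) => k.1 i j hij.ne) h1
      simpa [upperSystem, hij.le] using this
    · exact congrFun h3 i
    · have := congrArg (fun k : MonoSystem (c + 1) => k.1 i j hij.ne') h2
      simpa [lowerSystem, hij.le] using this
  refine (Nat.card_le_card_of_injective _ hinj).trans_eq ?_
  rw [Nat.card_prod, Nat.card_prod, Nat.card_fun, Nat.card_fin]
  ring

theorem card_monoSystem_sq_le (c : ℕ) :
    Nat.card (MonoSystem (c + 1)) ^ 2 ≤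
      Nat.card (boxArrays (c + 1) c) * ((c + 1) ^ (c + 1)) ^ 2 := by
  classical
  have := Fintype.ofFinite (MonoSystem (c + 1))
  set K := Nat.sqrt (Nat.card (boxArrays (c + 1) c)) with hK
  have hfib : ∀ d ∈ univ.image (MonoSystem.diag (c := c)),
      #{k ∈ univ | MonoSystem.diag k = d} ≤ K := by
    intro d _
    rw [hK, Nat.le_sqrt, ← Finset.card_product, ← Nat.card_eq_finsetCard]
    refine Nat.card_le_card_of_injective
      (fun q => ⟨q.1.1.glue q.1.2, MonoSystem.glue_mem (by
        have := q.2
        simp only [mem_product, mem_filter_univ] at this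
        rw [this.1, this.2])⟩) fun q r h => ?_
    obtain ⟨h1, h2⟩ := MonoSystem.glue_injective (Subtype.ext_iff.1 h)
    exact Subtype.ext (Prod.ext h1 h2)
  have h1 := Finset.card_le_mul_card_image univ K hfib
  have h2 : #(univ.image (MonoSystem.diag (c := c))) ≤ (c + 1) ^ (c + 1) := by
    refine (Finset.card_le_univ _).trans_eq ?_
    simp
  rw [Nat.card_eq_fintype_card]
  calc _ ≤ (K * (c + 1) ^ (c + 1)) ^ 2 :=
        Nat.pow_le_pow_left (h1.trans (Nat.mul_le_mul_left _ h2)) 2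
    _ = (K * K) * ((c + 1) ^ (c + 1)) ^ 2 := by ring
    _ ≤ _ := Nat.mul_le_mul_right _ (Nat.sqrt_le _)

theorem log_succ_sub_log_mem_Icc {m : ℕ} (hm : 1 ≤ m) :
    Real.log (m + 1) - Real.log m ∈ Set.Icc (1 / ((m : ℝ) + 1)) (1 / m) := by
  have hm0 : (0 : ℝ) < m := by exact_mod_cast hm
  rw [← Real.log_div (by positivity) (by positivity)]
  constructor
  · refine le_trans (le_of_eq ?_) (Real.one_sub_inv_le_log_of_pos (by positivity))
    field_simp
    ring
  · refine (Real.log_le_sub_one_of_pos (by positivity)).trans_eq ?_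
    field_simp
    ring

theorem log_factorial_mem_Icc {m : ℕ} (hm : 1 ≤ m) :
    Real.log m ! ∈ Set.Icc (m * Real.log m - m) (m * Real.log m - m + Real.log m + 1) := by
  induction m, hm using Nat.le_induction with
  | base => simp
  | succ m hm ih =>
    have hm0 : (0 : ℝ) < m := by exact_mod_cast hm
    obtain ⟨h1, h2⟩ := log_succ_sub_log_mem_Icc hm
    obtain ⟨h3, h4⟩ := ih
    rw [div_le_iff₀ (by positivity)] at h1
    rw [le_div_iff₀ (by positivity)] at h2
    rw [Nat.factorial_succ, Nat.cast_mul, Real.log_mul (by positivity) (by positivity)]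
    push_cast
    constructor <;> nlinarith

theorem abs_sum_log_factorial_sub_le (m : ℕ) :
    |∑ i ∈ range m, Real.log i ! - ((m : ℝ) ^ 2 / 2 * Real.log m - 3 / 4 * (m : ℝ) ^ 2)| ≤
      m * (Real.log m + 3) := by
  induction m with
  | zero => simp
  | succ m ih =>
    rcases Nat.eq_zero_or_pos m with rfl | hm
    · norm_num
    have hm1 : (1 : ℝ) ≤ m := by exact_mod_cast hm
    obtain ⟨h1, h2⟩ := log_succ_sub_log_mem_Icc hm
    obtain ⟨h3, h4⟩ := log_factorial_mem_Icc hm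
    have h0 : 0 ≤ Real.log m := Real.log_nonneg hm1
    rw [div_le_iff₀ (by positivity)] at h1
    rw [le_div_iff₀ (by positivity)] at h2
    rw [sum_range_succ]
    push_cast
    generalize ∑ i ∈ range m, Real.log i ! = S at *
    generalize Real.log m ! = F at *
    obtain ⟨d, hd⟩ : ∃ d, Real.log (m + 1) = Real.log m + d := ⟨_, (add_sub_cancel _ _).symm⟩
    rw [hd] at h1 h2 ⊢
    rw [add_sub_cancel_left] at h1 h2
    generalize Real.log m = L at *
    generalize (m : ℝ) = x at *
    have hd0 : 0 ≤ d := by nlinarith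
    have hd1 : d ≤ 1 := by nlinarith
    have h5 : (x + 1) ^ 2 * d ≤ x + 3 := by nlinarith
    have h6 : x + 1 ≤ (x + 1) ^ 2 * d := by nlinarith
    rw [abs_le] at ih ⊢
    constructor <;> nlinarith

theorem log_card_boxArrays (c : ℕ) :
    Real.log (Nat.card (boxArrays (c + 1) c)) =
      ∑ i ∈ range (3 * (c + 1)), Real.log i ! - 3 * ∑ i ∈ range (2 * (c + 1)), Real.log i ! +
        3 * ∑ i ∈ range (c + 1), Real.log i ! - Real.log (3 * c + 2)! +
        2 * Real.log (2 * c + 1)! - Real.log c ! := by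
  have hpos : ∀ (m k : ℕ), (∏ i ∈ range m, ((k + i)! : ℝ)) ≠ 0 := fun m k => by positivity
  have hlog : ∀ m k : ℕ, Real.log (∏ i ∈ range m, ((k + i)! : ℝ)) =
      ∑ i ∈ range (k + m), Real.log i ! - ∑ i ∈ range k, Real.log i ! := fun m k => by
    rw [sum_range_add, add_sub_cancel_left, Real.log_prod fun i _ => by positivity]
  have hlog0 : ∀ m : ℕ, Real.log (∏ i ∈ range m, (i ! : ℝ)) = ∑ i ∈ range m, Real.log i ! :=
    fun m => Real.log_prod fun i _ => by positivity
  have hpos0 : ∀ (m : ℕ), (∏ i ∈ range m, (i ! : ℝ)) ≠ 0 := fun m => by positivity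
  have h : ((∏ i ∈ range (c + 1 + (c + 1)), (i ! : ℝ)) * Nat.card (boxArrays (c + 1) c)) *
      ∏ i ∈ range (c + 1), ((c + i)! : ℝ) = ((∏ i ∈ range (c + 1), (i ! : ℝ)) *
        ∏ i ∈ range (c + 1), (i ! : ℝ)) * ∏ i ∈ range (c + 1), ((c + 1 + c + i)! : ℝ) := by
    exact_mod_cast prod_factorial_mul_card_boxArrays (c + 1) c
  have hcard : (Nat.card (boxArrays (c + 1) c) : ℝ) ≠ 0 := by
    intro h0
    rw [h0, mul_zero, zero_mul] at h
    exact mul_ne_zero (mul_ne_zero (hpos0 _) (hpos0 _)) (hpos _ _) h.symm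
  have h' := congrArg Real.log h
  rw [Real.log_mul (mul_ne_zero (hpos0 _) hcard) (hpos _ _), Real.log_mul (hpos0 _) hcard,
    Real.log_mul (mul_ne_zero (hpos0 _) (hpos0 _)) (hpos _ _),
    Real.log_mul (hpos0 _) (hpos0 _), hlog, hlog, hlog0, hlog0] at h'
  rw [show c + 1 + (c + 1) = 2 * c + 1 + 1 by ring, show c + (c + 1) = 2 * c + 1 by ring,
    show c + 1 + c + (c + 1) = 3 * c + 2 by ring, show c + 1 + c = 2 * c + 1 by ring,
    sum_range_succ _ (2 * c + 1), sum_range_succ _ c] at h'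
  rw [show 3 * (c + 1) = 3 * c + 2 + 1 by ring, show 2 * (c + 1) = 2 * c + 1 + 1 by ring,
    sum_range_succ _ (3 * c + 2), sum_range_succ _ (2 * c + 1), sum_range_succ _ c]
  linarith

theorem abs_log_card_boxArrays_sub_le (c : ℕ) :
    |Real.log (Nat.card (boxArrays (c + 1) c)) -
        ((c + 1 : ℕ) : ℝ) ^ 2 * (9 / 2 * Real.log 3 - 6 * Real.log 2)| ≤
      ((c + 1 : ℕ) : ℝ) * (24 * Real.log (3 * (c + 1 : ℕ)) + 36) := by
  rw [log_card_boxArrays]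
  have hf : ∀ m ≤ 3 * (c + 1), 0 ≤ Real.log m ! ∧
      Real.log m ! ≤ 3 * (c + 1 : ℕ) * Real.log (3 * (c + 1 : ℕ)) := by
    intro m hm
    have h1 : (1 : ℝ) ≤ m ! := by exact_mod_cast Nat.factorial_pos m
    refine ⟨Real.log_nonneg h1, ?_⟩
    have h2 : (m ! : ℝ) ≤ ((3 * (c + 1) : ℕ) : ℝ) ^ (3 * (c + 1)) := by
      exact_mod_cast (Nat.factorial_le hm).trans (Nat.factorial_le_pow _)
    refine (Real.log_le_log (by positivity) h2).trans_eq ?_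
    rw [Real.log_pow]
    push_cast
    ring
  have h1 := hf (3 * c + 2) (by omega)
  have h2 := hf (2 * c + 1) (by omega)
  have h3 := hf c (by omega)
  have g1 := abs_sum_log_factorial_sub_le (c + 1)
  have g2 := abs_sum_log_factorial_sub_le (2 * (c + 1))
  have g3 := abs_sum_log_factorial_sub_le (3 * (c + 1))
  have hx : (0 : ℝ) < ((c + 1 : ℕ) : ℝ) := by positivity
  rw [Nat.cast_mul] at g2 g3
  generalize ((c + 1 : ℕ) : ℝ) = x at *
  push_cast at g2 g3
  rw [Real.log_mul (by norm_num) hx.ne'] at *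
  have l2 : 0 ≤ Real.log 2 := Real.log_nonneg (by norm_num)
  have l3 : 0 ≤ Real.log 3 := Real.log_nonneg (by norm_num)
  have l23 : Real.log 2 ≤ Real.log 3 := Real.log_le_log (by norm_num) (by norm_num)
  rw [abs_le] at g1 g2 g3 ⊢
  have := mul_nonneg hx.le l3
  have := mul_le_mul_of_nonneg_left l23 hx.le
  constructor <;> nlinarith

theorem abs_log_card_monoSystem_sub_le (n : ℕ) (hn : n ≠ 0) :
    |Real.log (Nat.card (MonoSystem n)) / (n : ℝ) ^ 2 -
        (3 / 4) * (3 * Real.log 3 - 4 * Real.log 2)| ≤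
      13 * (Real.log (3 * n) / n) + 18 * (1 / n) := by
  obtain ⟨c, rfl⟩ := Nat.exists_eq_succ_of_ne_zero hn
  rw [Nat.succ_eq_add_one]
  have hne : Nonempty (MonoSystem (c + 1)) :=
    ⟨⟨fun _ _ _ => 0, fun _ _ _ => rfl, fun _ _ _ _ _ _ => le_rfl⟩⟩
  have hM : (0 : ℝ) < Nat.card (MonoSystem (c + 1)) := by exact_mod_cast Nat.card_pos
  have hB : (0 : ℝ) < Nat.card (boxArrays (c + 1) c) := by
    have : Nonempty (boxArrays (c + 1) c) :=
      ⟨⟨fun _ _ => 0, fun _ _ _ _ => le_rfl, fun _ _ _ _ => le_rfl⟩⟩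
    exact_mod_cast Nat.card_pos
  have h1 : (Nat.card (boxArrays (c + 1) c) : ℝ) ≤
      (Nat.card (MonoSystem (c + 1)) : ℝ) ^ 2 * ((c + 1 : ℕ) : ℝ) ^ (c + 1) := by
    exact_mod_cast card_boxArrays_le c
  have h2 : (Nat.card (MonoSystem (c + 1)) : ℝ) ^ 2 ≤
      Nat.card (boxArrays (c + 1) c) * (((c + 1 : ℕ) : ℝ) ^ (c + 1)) ^ 2 := by
    exact_mod_cast card_monoSystem_sq_le c
  have hx : (1 : ℝ) ≤ ((c + 1 : ℕ) : ℝ) := by norm_num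
  have hx0 : (0 : ℝ) < ((c + 1 : ℕ) : ℝ) := by linarith
  replace h1 := Real.log_le_log hB h1
  replace h2 := Real.log_le_log (by positivity) h2
  rw [Real.log_mul (by positivity) (by positivity), Real.log_pow, Real.log_pow] at h1
  rw [Real.log_mul (by positivity) (by positivity), Real.log_pow, Real.log_pow,
    Real.log_pow] at h2
  have h3 := abs_log_card_boxArrays_sub_le c
  have hlog : Real.log ((c + 1 : ℕ) : ℝ) ≤ Real.log (3 * (c + 1 : ℕ)) :=
    Real.log_le_log (by linarith) (by linarith)
  have hlog0 := Real.log_nonneg hx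
  push_cast [-Nat.cast_add, -Nat.cast_succ] at h1 h2
  generalize ((c + 1 : ℕ) : ℝ) = x at *
  have h4 := mul_le_mul_of_nonneg_left hlog hx0.le
  rw [show 13 * (Real.log (3 * x) / x) + 18 * (1 / x) =
    (x * (13 * Real.log (3 * x) + 18)) / x ^ 2 by field_simp]
  rw [show Real.log (Nat.card (MonoSystem (c + 1))) / x ^ 2 -
      (3 / 4) * (3 * Real.log 3 - 4 * Real.log 2) = (Real.log (Nat.card (MonoSystem (c + 1))) -
        x ^ 2 * ((3 / 4) * (3 * Real.log 3 - 4 * Real.log 2))) / x ^ 2 by field_simp,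
    abs_div, abs_of_pos (pow_pos hx0 2)]
  refine div_le_div_of_nonneg_right ?_ (by positivity)
  rw [abs_le] at h3 ⊢
  constructor <;> nlinarith

end

theorem count_monotone_systems :
    Filter.Tendsto
      (fun n : ℕ => Real.log (Nat.card (MonoSystem n)) / (n : ℝ) ^ 2)
      Filter.atTop
      (nhds ((3 / 4) * (3 * Real.log 3 - 4 * Real.log 2))) := by
  have hone : Filter.Tendsto (fun n : ℕ => 1 / (n : ℝ)) Filter.atTop (nhds 0) :=
    tendsto_one_div_atTop_nhds_zero_nat
  have hlog : Filter.Tendsto (fun n : ℕ => Real.log (3 * n) / (n : ℝ)) Filter.atTop (nhds 0) := by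
    have h := (Real.isLittleO_log_id_atTop.tendsto_div_nhds_zero).comp
      ((tendsto_natCast_atTop_atTop (R := ℝ)).const_mul_atTop (by norm_num : (0 : ℝ) < 3))
    have h3 := h.const_mul 3
    rw [mul_zero] at h3
    refine h3.congr fun n => ?_
    simp only [Function.comp_apply, id_eq]
    rw [← mul_div_assoc, mul_div_mul_left _ _ (by norm_num : (3 : ℝ) ≠ 0)]
  rw [tendsto_iff_dist_tendsto_zero]
  refine squeeze_zero' (Filter.Eventually.of_forall fun _ => dist_nonneg) ?_
    (g := fun n : ℕ => 13 * (Real.log (3 * n) / n) + 18 * (1 / (n : ℝ))) ?_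
  · filter_upwards [Filter.eventually_ne_atTop 0] with n hn
    exact abs_log_card_monoSystem_sub_le n hn
  · simpa using (hlog.const_mul 13).add (hone.const_mul 18)
end

section
/- Fix an integer d ≥ 1. For every ε > 0 there exists N such that for all n ≥ N there are at least n^{(1−ε)C(n,d)} intersection-closed families F ⊆ 2^{[n]} that are maximum classes of VC dimension d, i.e. families that are closed under pairwise intersection, have VC dimension exactly d, and satisfy |F| = Σ_{i=0}^{d} C(n,i). In particular, the number m(n,d) of maximum classes of VC dimension d on ground set [n] is n^{C(n,d)(1−o(1))}. -/
open SimpleGraph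

/-- The family `F` shatters the set `S`. -/
def Shatters {n : ℕ} (F : Finset (Finset (Fin n))) (S : Finset (Fin n)) : Prop :=
  ∀ B ⊆ S, ∃ A ∈ F, A ∩ S = B

section Construction

variable {n d : ℕ} {R : Finset (Fin n)}

/-- Adds to each `d`-set `A` disjoint from `R` the element of `R` that `f` assigns to `A`; all other
sets are unchanged. -/
def enlarge (f : Rᶜ.powersetCard d → R) (A : Finset (Fin n)) : Finset (Fin n) :=
  if h : A ∈ Rᶜ.powersetCard d then insert (f ⟨A, h⟩ : Fin n) A else A

/-- The images under `enlarge f` of all sets of size at most `d`. -/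
def enlargedFamily (f : Rᶜ.powersetCard d → R) : Finset (Finset (Fin n)) :=
  ({A : Finset (Fin n) | A.card ≤ d} : Finset _).image (enlarge f)

variable {f : Rᶜ.powersetCard d → R} {A S : Finset (Fin n)}

lemma enlarge_of_mem (h : A ∈ Rᶜ.powersetCard d) :
    enlarge f A = insert (f ⟨A, h⟩ : Fin n) A := dif_pos h

lemma enlarge_of_notMem (h : A ∉ Rᶜ.powersetCard d) : enlarge f A = A := dif_neg h

lemma subset_enlarge : A ⊆ enlarge f A := by
  unfold enlarge
  split_ifs
  · exact Finset.subset_insert _ _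
  · exact subset_rfl

lemma apply_notMem (h : S ∈ Rᶜ.powersetCard d) : (f ⟨S, h⟩ : Fin n) ∉ S := fun hS ↦
  Finset.mem_compl.1 ((Finset.mem_powersetCard.1 h).1 hS) (f ⟨S, h⟩).2

lemma card_enlarge_of_mem (h : A ∈ Rᶜ.powersetCard d) : (enlarge f A).card = d + 1 := by
  rw [enlarge_of_mem h, Finset.card_insert_of_notMem (apply_notMem h),
    (Finset.mem_powersetCard.1 h).2]

/-- The only member of the enlarged family that contains a `d`-set `S` disjoint from `R` is
`enlarge f S`. -/
lemma eq_of_subset_enlarge (hS : S ∈ Rᶜ.powersetCard d) (hA : A.card ≤ d)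
    (h : S ⊆ enlarge f A) : A = S := by
  obtain ⟨hSR, hSd⟩ := Finset.mem_powersetCard.1 hS
  refine (Finset.eq_of_subset_of_card_le ?_ (hSd ▸ hA)).symm
  by_cases hAm : A ∈ Rᶜ.powersetCard d
  · intro x hx
    have hxA := h hx
    rw [enlarge_of_mem hAm, Finset.mem_insert] at hxA
    refine hxA.resolve_left ?_
    rintro rfl
    exact Finset.mem_compl.1 (hSR hx) (f ⟨A, hAm⟩).2
  · rwa [enlarge_of_notMem hAm] at h

lemma mem_enlargedFamily :
    S ∈ enlargedFamily f ↔ ∃ A : Finset (Fin n), A.card ≤ d ∧ enlarge f A = S := by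
  simp [enlargedFamily]

lemma mem_enlargedFamily_of_card_le (hA : A.card ≤ d) (h : A ∉ Rᶜ.powersetCard d) :
    A ∈ enlargedFamily f :=
  mem_enlargedFamily.2 ⟨A, hA, enlarge_of_notMem h⟩

lemma injOn_enlarge : Set.InjOn (enlarge f) {A | A.card ≤ d} := by
  intro A hA B hB h
  by_cases hAm : A ∈ Rᶜ.powersetCard d
  · exact (eq_of_subset_enlarge hAm hB (subset_enlarge.trans h.subset)).symm
  by_cases hBm : B ∈ Rᶜ.powersetCard d
  · exact eq_of_subset_enlarge hBm hA (subset_enlarge.trans h.superset)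
  rwa [enlarge_of_notMem hAm, enlarge_of_notMem hBm] at h

lemma card_filter_card_le (n d : ℕ) :
    ({A : Finset (Fin n) | A.card ≤ d} : Finset _).card =
      ∑ i ∈ Finset.range (d + 1), n.choose i := by
  rw [Finset.card_eq_sum_card_fiberwise (f := Finset.card) (t := Finset.range (d + 1))
    (fun A hA ↦ by simpa [Nat.lt_succ_iff] using hA)]
  refine Finset.sum_congr rfl fun i hi ↦ ?_
  have : i ≤ d := Nat.lt_succ_iff.1 (Finset.mem_range.1 hi)
  rw [← Finset.card_fin n, ← Finset.card_powersetCard, Finset.card_fin]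
  congr 1
  ext A
  simp only [Finset.mem_filter, Finset.mem_univ, true_and, Finset.mem_powersetCard,
    Finset.subset_univ]
  omega

lemma card_enlargedFamily :
    (enlargedFamily f).card = ∑ i ∈ Finset.range (d + 1), n.choose i := by
  rw [enlargedFamily, Finset.card_image_of_injOn (by simpa using injOn_enlarge),
    card_filter_card_le]

lemma inter_mem_enlargedFamily {X Y : Finset (Fin n)} (hX : X ∈ enlargedFamily f)
    (hY : Y ∈ enlargedFamily f) : X ∩ Y ∈ enlargedFamily f := by
  obtain ⟨A, hA, rfl⟩ := mem_enlargedFamily.1 hX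
  obtain ⟨B, hB, rfl⟩ := mem_enlargedFamily.1 hY
  by_cases hAB : A = B
  · simpa [hAB] using hY
  refine mem_enlargedFamily_of_card_le ?_ fun h ↦ hAB ?_
  · by_cases hAm : A ∈ Rᶜ.powersetCard d
    · by_contra! hlt
      have hle : (enlarge f A).card ≤ (enlarge f A ∩ enlarge f B).card := by
        rw [card_enlarge_of_mem hAm]; exact hlt
      have hsub := Finset.inter_eq_left.1 (Finset.eq_of_subset_of_card_le
        Finset.inter_subset_left hle)
      exact hAB (eq_of_subset_enlarge hAm hB (subset_enlarge.trans hsub)).symm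
    · rw [enlarge_of_notMem hAm]
      exact (Finset.card_le_card Finset.inter_subset_left).trans hA
  · exact (eq_of_subset_enlarge h hA Finset.inter_subset_left).trans
      (eq_of_subset_enlarge h hB Finset.inter_subset_right).symm

lemma shatters_enlargedFamily (hS : S.card = d) : Shatters (enlargedFamily f) S := by
  intro B hB
  have hBd : B.card ≤ d := hS ▸ Finset.card_le_card hB
  refine ⟨enlarge f B, mem_enlargedFamily.2 ⟨B, hBd, rfl⟩, ?_⟩
  by_cases hBm : B ∈ Rᶜ.powersetCard d
  · obtain rfl : B = S := Finset.eq_of_subset_of_card_le hB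
      (by rw [hS, (Finset.mem_powersetCard.1 hBm).2])
    exact Finset.inter_eq_right.2 subset_enlarge
  · rw [enlarge_of_notMem hBm, Finset.inter_eq_left.2 hB]

lemma card_le_of_shatters_enlargedFamily (hS : Shatters (enlargedFamily f) S) : S.card ≤ d := by
  by_contra! hlt
  obtain ⟨X, hX, hXS⟩ := hS S subset_rfl
  obtain ⟨A, hA, rfl⟩ := mem_enlargedFamily.1 hX
  have hSA := Finset.inter_eq_right.1 hXS
  by_cases hAm : A ∈ Rᶜ.powersetCard d
  · obtain rfl : S = enlarge f A := Finset.eq_of_subset_of_card_le hSA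
      (by rw [card_enlarge_of_mem hAm]; exact hlt)
    obtain ⟨Y, hY, hYA⟩ := hS A subset_enlarge
    obtain ⟨B, hB, rfl⟩ := mem_enlargedFamily.1 hY
    obtain rfl := eq_of_subset_enlarge (f := f) hAm hB
      (hYA.symm.subset.trans Finset.inter_subset_left)
    rw [Finset.inter_self] at hYA
    rw [hYA] at hlt
    omega
  · rw [enlarge_of_notMem hAm] at hSA
    exact absurd (Finset.card_le_card hSA) (by omega)

lemma injective_enlargedFamily :
    Function.Injective (enlargedFamily : (Rᶜ.powersetCard d → R) → _) := by
  intro f g hfg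
  ext ⟨S, hS⟩ : 1
  have hSd := (Finset.mem_powersetCard.1 hS).2
  have hmem : enlarge f S ∈ enlargedFamily g :=
    hfg ▸ mem_enlargedFamily.2 ⟨S, hSd.le, rfl⟩
  obtain ⟨A, hA, hAS⟩ := mem_enlargedFamily.1 hmem
  obtain rfl := eq_of_subset_enlarge hS hA (subset_enlarge.trans hAS.superset)
  rw [enlarge_of_mem hS, enlarge_of_mem hS] at hAS
  have h : (f ⟨A, hS⟩ : Fin n) ∈ insert (g ⟨A, hS⟩ : Fin n) A :=
    hAS ▸ Finset.mem_insert_self _ _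
  exact Subtype.ext ((Finset.mem_insert.1 h).resolve_right (apply_notMem hS))

end Construction

/-- There are at least `r ^ (n - r).choose d` intersection-closed maximum classes. -/
lemma pow_choose_le_card_intersection_closed_maximum_classes {n d r : ℕ} (hd : d ≤ n)
    (hr : r ≤ n) :
    r ^ (n - r).choose d ≤ Nat.card {F : Finset (Finset (Fin n)) //
      (∀ A ∈ F, ∀ B ∈ F, A ∩ B ∈ F) ∧
      (∃ S : Finset (Fin n), S.card = d ∧ Shatters F S) ∧
      (∀ S : Finset (Fin n), Shatters F S → S.card ≤ d) ∧
      F.card = ∑ i ∈ Finset.range (d + 1), n.choose i} := by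
  obtain ⟨R, -, hR⟩ := Finset.exists_subset_card_eq (s := (Finset.univ : Finset (Fin n)))
    (n := r) (by simpa using hr)
  obtain ⟨S, -, hS⟩ := Finset.exists_subset_card_eq (s := (Finset.univ : Finset (Fin n)))
    (n := d) (by simpa using hd)
  have hcard : Nat.card (Rᶜ.powersetCard d → R) = r ^ (n - r).choose d := by
    rw [Nat.card_fun, Nat.card_eq_finsetCard, Nat.card_eq_finsetCard, Finset.card_powersetCard,
      Finset.card_compl, Fintype.card_fin, hR]
  rw [← hcard]
  exact Nat.card_le_card_of_injective
    (fun f ↦ ⟨enlargedFamily f, fun A hA B hB ↦ inter_mem_enlargedFamily hA hB,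
      ⟨S, hS, shatters_enlargedFamily hS⟩, fun T hT ↦ card_le_of_shatters_enlargedFamily hT,
      card_enlargedFamily⟩)
    fun f g h ↦ injective_enlargedFamily (congrArg Subtype.val h)

lemma choose_add_le_choose_add_mul (m r d : ℕ) :
    (m + r).choose (d + 1) ≤ m.choose (d + 1) + r * (m + r - 1).choose d := by
  induction r with
  | zero => simp
  | succ r ih =>
    have hmono : (m + r - 1).choose d ≤ (m + r).choose d :=
      Nat.choose_le_choose d (Nat.sub_le _ _)
    have hmul := Nat.mul_le_mul_left r hmono
    rw [← Nat.add_assoc, Nat.choose_succ_succ', Nat.add_sub_cancel, Nat.succ_mul]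
    omega

lemma one_sub_mul_choose_le_choose_sub {n r d : ℕ} (hd : 1 ≤ d) (hr : r ≤ n) (hn : 0 < n) :
    (1 - r * d / n : ℝ) * n.choose d ≤ (n - r).choose d := by
  obtain ⟨d, rfl⟩ := Nat.exists_eq_add_of_le' hd
  obtain ⟨n, rfl⟩ := Nat.exists_eq_add_of_le' hn
  have h := choose_add_le_choose_add_mul (n + 1 - r) r d
  rw [Nat.sub_add_cancel hr, Nat.add_sub_cancel] at h
  have hR : ((n + 1).choose (d + 1) : ℝ) ≤
      (n + 1 - r).choose (d + 1) + r * n.choose d := by exact_mod_cast h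
  have habs : ((n + 1 : ℕ) : ℝ) * n.choose d = (n + 1).choose (d + 1) * ((d + 1 : ℕ) : ℝ) := by
    exact_mod_cast Nat.add_one_mul_choose_eq n d
  have : (r * ((d + 1 : ℕ) : ℝ) / ((n + 1 : ℕ) : ℝ)) * (n + 1).choose (d + 1) =
      r * n.choose d := by
    field_simp
    linear_combination -(r : ℝ) * habs
  rw [sub_mul, one_mul, this]
  linarith

lemma tendsto_ceil_rpow_mul_div {δ : ℝ} (hδ : 0 < δ) (c : ℝ) :
    Filter.Tendsto (fun n : ℕ ↦ (⌈(n : ℝ) ^ (1 - δ)⌉₊ : ℝ) * c / n) Filter.atTop (nhds 0) := by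
  have hpow : Filter.Tendsto (fun n : ℕ ↦ (n : ℝ) ^ (-δ) + 1 / (n : ℝ)) Filter.atTop
      (nhds 0) := by
    simpa using ((tendsto_rpow_neg_atTop hδ).comp tendsto_natCast_atTop_atTop).add
      tendsto_one_div_atTop_nhds_zero_nat
  have hdiv : Filter.Tendsto (fun n : ℕ ↦ (⌈(n : ℝ) ^ (1 - δ)⌉₊ : ℝ) / n) Filter.atTop
      (nhds 0) := by
    refine tendsto_of_tendsto_of_tendsto_of_le_of_le' tendsto_const_nhds hpow
      (.of_forall fun n ↦ by positivity) ?_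
    filter_upwards [Filter.eventually_gt_atTop 0] with n hn
    have hn' : (0 : ℝ) < n := by exact_mod_cast hn
    rw [div_le_iff₀ hn', add_mul, one_div_mul_cancel hn'.ne', ← Real.rpow_add_one hn'.ne',
      neg_add_eq_sub]
    exact (Nat.ceil_lt_add_one (by positivity)).le
  simpa [div_mul_eq_mul_div] using hdiv.mul_const c

theorem many_intersection_closed_maximum_classes (d : ℕ) (hd : 1 ≤ d) :
    ∀ ε : ℝ, 0 < ε → ∃ N : ℕ, ∀ n : ℕ, N ≤ n →
      (n : ℝ) ^ ((1 - ε) * (n.choose d : ℝ)) ≤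
        (Nat.card {F : Finset (Finset (Fin n)) //
          (∀ A ∈ F, ∀ B ∈ F, A ∩ B ∈ F) ∧
          (∃ S : Finset (Fin n), S.card = d ∧ Shatters F S) ∧
          (∀ S : Finset (Fin n), Shatters F S → S.card ≤ d) ∧
          F.card = ∑ i ∈ Finset.range (d + 1), n.choose i} : ℝ) := by
  intro ε hε
  set δ : ℝ := min ε 1 / 2 with hδ_def
  have hδ : 0 < δ := by positivity
  have hδε : 2 * δ ≤ ε := by rw [hδ_def]; linarith [min_le_left ε 1]
  have hδ1 : 2 * δ ≤ 1 := by rw [hδ_def]; linarith [min_le_right ε 1]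
  refine Filter.eventually_atTop.1 ?_
  filter_upwards [(tendsto_ceil_rpow_mul_div hδ d).eventually_le_const hδ,
    Filter.eventually_ge_atTop d] with n hnδ hdn
  have hn : 0 < n := by omega
  have hn1 : (1 : ℝ) ≤ n := by exact_mod_cast hn
  set r := ⌈(n : ℝ) ^ (1 - δ)⌉₊
  have hr : r ≤ n := by
    refine Nat.ceil_le.2 ?_
    simpa using Real.rpow_le_rpow_of_exponent_le hn1 (show 1 - δ ≤ 1 by linarith)
  have hchoose : (1 - δ) * n.choose d ≤ ((n - r).choose d : ℝ) :=
    le_trans (by gcongr) (one_sub_mul_choose_le_choose_sub hd hr hn)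
  calc (n : ℝ) ^ ((1 - ε) * (n.choose d : ℝ))
      ≤ (n : ℝ) ^ ((1 - δ) * ((n - r).choose d : ℝ)) := by
        refine Real.rpow_le_rpow_of_exponent_le hn1 ?_
        calc (1 - ε) * (n.choose d : ℝ) ≤ (1 - δ) * (1 - δ) * n.choose d := by
              gcongr
              nlinarith
          _ = (1 - δ) * ((1 - δ) * n.choose d) := mul_assoc _ _ _
          _ ≤ (1 - δ) * ((n - r).choose d : ℝ) :=
              mul_le_mul_of_nonneg_left hchoose (by linarith)
    _ = ((n : ℝ) ^ (1 - δ)) ^ (n - r).choose d := by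
        rw [Real.rpow_mul (by positivity), Real.rpow_natCast]
    _ ≤ (r : ℝ) ^ (n - r).choose d := by
        gcongr
        exact Nat.le_ceil _
    _ ≤ _ := by
        exact_mod_cast pow_choose_le_card_intersection_closed_maximum_classes hdn hr
end
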